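/- There is an absolute constant C > 0 such that for every fixed integer r ≥ 1, with probability tending to 1 as n → ∞ over G ← G(n,1/2), the polynomial system Clique(G,k) admits no PS(r) refutation for any positive integer k ≤ n^{1/(2r)}/(C^r (log n)^{1/r}). -/

import Mathlib

open Finset Filter MvPolynomial

open scoped Classical in
/-- A degree-`r` Positivstellensatz refutation of the system `Clique(G,k)`, consisting of
the axioms `xᵢ² − xᵢ` (`i ∈ [n]`), `xᵢ·xⱼ` (`{i,j}` a non-edge of `G`), and `Σᵢ xᵢ − k`:
an identity `Σ fᵢ·gᵢ = 1 + Σ hⱼ²` with `deg(fᵢ·gᵢ) ≤ 2r` and `deg(hⱼ) ≤ r`. -/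
def HasPSRefutationClique (n r k : ℕ) (G : SimpleGraph (Fin n)) : Prop :=
  ∃ (g₁ : Fin n → MvPolynomial (Fin n) ℝ) (g₂ : Fin n → Fin n → MvPolynomial (Fin n) ℝ)
    (g₃ : MvPolynomial (Fin n) ℝ) (N : ℕ) (h : Fin N → MvPolynomial (Fin n) ℝ),
    (∀ i, ((X i ^ 2 - X i) * g₁ i).totalDegree ≤ 2 * r) ∧
    (∀ i j, i ≠ j → ¬ G.Adj i j → ((X i * X j) * g₂ i j).totalDegree ≤ 2 * r) ∧
    (((∑ i, X i - C (k : ℝ)) * g₃).totalDegree ≤ 2 * r) ∧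
    (∀ j, (h j).totalDegree ≤ r) ∧
    ((∑ i, (X i ^ 2 - X i) * g₁ i)
      + (∑ i, ∑ j, if i ≠ j ∧ ¬ G.Adj i j then (X i * X j) * g₂ i j else 0)
      + (∑ i, X i - C (k : ℝ)) * g₃
      = 1 + ∑ j, (h j) ^ 2)

section Mixing

variable {ι V : Type*} [Fintype ι] [DecidableEq ι] [Fintype V]

/-- Resampling the coordinates in `A` does not change the total sum. -/
theorem sum_sum_piecewise (A : Finset ι) (f : (ι → V) → ℝ) :
    ∑ φ : ι → V, ∑ ψ : ι → V, f (A.piecewise ψ φ)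
      = (Fintype.card V : ℝ) ^ Fintype.card ι * ∑ φ, f φ := by
  classical
  let e : (ι → V) × (ι → V) ≃ (ι → V) × (ι → V) :=
    { toFun := fun p => (A.piecewise p.2 p.1, A.piecewise p.1 p.2)
      invFun := fun p => (A.piecewise p.2 p.1, A.piecewise p.1 p.2)
      left_inv := fun p => by
        ext i <;> by_cases h : i ∈ A <;> simp [h]
      right_inv := fun p => by
        ext i <;> by_cases h : i ∈ A <;> simp [h] }
  have h1 : ∑ p : (ι → V) × (ι → V), f (A.piecewise p.2 p.1)
      = ∑ p : (ι → V) × (ι → V), f p.1 := by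
    rw [← Equiv.sum_comp e (fun p => f p.1)]
    rfl
  rw [← Fintype.sum_prod_type' (fun φ ψ => f (A.piecewise ψ φ)), h1, Fintype.sum_prod_type,
    Finset.mul_sum]
  simp

/-- Functions depending on disjoint sets of coordinates are uncorrelated. -/
theorem card_pow_mul_sum_mul (A : Finset ι) (F H : (ι → V) → ℝ)
    (hF : ∀ φ ψ, (∀ i ∈ A, φ i = ψ i) → F φ = F ψ)
    (hH : ∀ φ ψ, (∀ i, i ∉ A → φ i = ψ i) → H φ = H ψ) :
    (Fintype.card V : ℝ) ^ Fintype.card ι * ∑ φ, F φ * H φ = (∑ φ, F φ) * ∑ φ, H φ := by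
  rw [← sum_sum_piecewise A, Finset.sum_comm, Finset.sum_mul_sum]
  refine Finset.sum_congr rfl fun ψ _ => Finset.sum_congr rfl fun φ _ => ?_
  rw [hF (A.piecewise ψ φ) ψ fun i hi => by simp [hi],
    hH (A.piecewise ψ φ) φ fun i hi => by simp [hi]]

/-- Resampling one coordinate. -/
theorem sum_sum_update (a : ι) (f : (ι → V) → ℝ) :
    ∑ φ : ι → V, ∑ u : V, f (Function.update φ a u) = (Fintype.card V : ℝ) * ∑ φ, f φ := by
  classical
  let e : (ι → V) × V ≃ (ι → V) × V :=
    { toFun := fun p => (Function.update p.1 a p.2, p.1 a)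
      invFun := fun p => (Function.update p.1 a p.2, p.1 a)
      left_inv := fun p => by simp
      right_inv := fun p => by simp }
  have h1 : ∑ p : (ι → V) × V, f (Function.update p.1 a p.2) = ∑ p : (ι → V) × V, f p.1 := by
    rw [← Equiv.sum_comp e (fun p => f p.1)]
    rfl
  rw [← Fintype.sum_prod_type' (fun φ u => f (Function.update φ a u)), h1,
    Fintype.sum_prod_type, Finset.mul_sum]
  simp

/-- A two-variable kernel with operator norm at most `l` on `V`, inserted between coordinates
`a` and `b`, couples functions of the remaining coordinates with norm at most `l / |V|`. -/
theorem card_mul_abs_sum_kernel_le (χ : V → V → ℝ) {l : ℝ} (hl : 0 ≤ l)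
    (hχ : ∀ p q : V → ℝ, |∑ u, ∑ v, χ u v * p u * q v|
      ≤ l * (√(∑ u, p u ^ 2) * √(∑ v, q v ^ 2)))
    {a b : ι} (hab : a ≠ b) (P Q : (ι → V) → ℝ)
    (hP : ∀ φ v, P (Function.update φ b v) = P φ)
    (hQ : ∀ φ u, Q (Function.update φ a u) = Q φ) :
    (Fintype.card V : ℝ) * |∑ φ, χ (φ a) (φ b) * P φ * Q φ|
      ≤ l * (√(∑ φ, P φ ^ 2) * √(∑ φ, Q φ ^ 2)) := by
  classical
  set n : ℝ := (Fintype.card V : ℝ) with hn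
  rcases isEmpty_or_nonempty V with hV | hV
  · have : n = 0 := by simp [hn]
    rw [this, zero_mul]; positivity
  have hn0 : 0 < n := by rw [hn]; exact_mod_cast Fintype.card_pos
  have key : n ^ 2 * ∑ φ, χ (φ a) (φ b) * P φ * Q φ
      = ∑ φ, ∑ u, ∑ v, χ u v * P (Function.update φ a u) * Q (Function.update φ b v) := by
    rw [pow_two, mul_assoc, ← sum_sum_update b, ← sum_sum_update a]
    refine Finset.sum_congr rfl fun φ _ => Finset.sum_congr rfl fun u _ =>
      Finset.sum_congr rfl fun v _ => ?_
    rw [hP, Function.update_comm hab, hQ]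
    simp [Function.update_of_ne hab.symm]
  have hb : |n ^ 2 * ∑ φ, χ (φ a) (φ b) * P φ * Q φ|
      ≤ l * (n * (√(∑ φ, P φ ^ 2) * √(∑ φ, Q φ ^ 2))) := by
    rw [key]
    calc _ ≤ ∑ φ, |∑ u, ∑ v, χ u v * P (Function.update φ a u) * Q (Function.update φ b v)| :=
          Finset.abs_sum_le_sum_abs _ _
      _ ≤ ∑ φ, l * (√(∑ u, P (Function.update φ a u) ^ 2)
            * √(∑ v, Q (Function.update φ b v) ^ 2)) := Finset.sum_le_sum fun φ _ => hχ _ _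
      _ = l * ∑ φ, √(∑ u, P (Function.update φ a u) ^ 2)
            * √(∑ v, Q (Function.update φ b v) ^ 2) := by rw [Finset.mul_sum]
      _ ≤ l * (√(∑ φ, ∑ u, P (Function.update φ a u) ^ 2)
            * √(∑ φ, ∑ v, Q (Function.update φ b v) ^ 2)) := by
          gcongr
          exact Real.sum_sqrt_mul_sqrt_le _ (fun φ => Finset.sum_nonneg fun _ _ => sq_nonneg _)
            (fun φ => Finset.sum_nonneg fun _ _ => sq_nonneg _)
      _ = _ := by
          rw [sum_sum_update a (fun φ => P φ ^ 2), sum_sum_update b (fun φ => Q φ ^ 2),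
            Real.sqrt_mul hn0.le, Real.sqrt_mul hn0.le]
          have := Real.mul_self_sqrt hn0.le
          calc _ = l * ((√n * √n) * (√(∑ φ, P φ ^ 2) * √(∑ φ, Q φ ^ 2))) := by ring
            _ = _ := by rw [this]
  rw [abs_mul, abs_of_nonneg (sq_nonneg n), pow_two] at hb
  have : n * (n * |∑ φ, χ (φ a) (φ b) * P φ * Q φ|)
      ≤ n * (l * (√(∑ φ, P φ ^ 2) * √(∑ φ, Q φ ^ 2))) := by linarith
  exact le_of_mul_le_mul_left this hn0

end Mixing

section PatternSum

variable {ι V : Type*}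

open scoped Classical in
/-- The adjacency indicator of `G`, as a real number. -/
noncomputable def adjInd (G : SimpleGraph V) (u v : V) : ℝ := if G.Adj u v then 1 else 0

theorem adjInd_nonneg (G : SimpleGraph V) (u v : V) : 0 ≤ adjInd G u v := by
  unfold adjInd; split_ifs <;> norm_num

theorem adjInd_le_one (G : SimpleGraph V) (u v : V) : adjInd G u v ≤ 1 := by
  unfold adjInd; split_ifs <;> norm_num

/-- The product of the adjacency indicators over the pairs in `H`, pulled back along `φ`. -/
noncomputable def patternInd (G : SimpleGraph V) (H : Finset (ι × ι)) (φ : ι → V) : ℝ :=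
  ∏ e ∈ H, adjInd G (φ e.1) (φ e.2)

theorem patternInd_nonneg (G : SimpleGraph V) (H : Finset (ι × ι)) (φ : ι → V) :
    0 ≤ patternInd G H φ :=
  Finset.prod_nonneg fun _ _ => adjInd_nonneg _ _ _

theorem patternInd_le_one (G : SimpleGraph V) (H : Finset (ι × ι)) (φ : ι → V) :
    patternInd G H φ ≤ 1 :=
  Finset.prod_le_one (fun _ _ => adjInd_nonneg _ _ _) fun _ _ => adjInd_le_one _ _ _

theorem patternInd_eq_one {G : SimpleGraph V} {H : Finset (ι × ι)} {φ : ι → V}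
    (h : ∀ e ∈ H, G.Adj (φ e.1) (φ e.2)) : patternInd G H φ = 1 :=
  Finset.prod_eq_one fun e he => by simp [adjInd, h e he]

theorem patternInd_eq_zero {G : SimpleGraph V} {H : Finset (ι × ι)} {φ : ι → V}
    {e : ι × ι} (he : e ∈ H) (h : ¬ G.Adj (φ e.1) (φ e.2)) : patternInd G H φ = 0 :=
  Finset.prod_eq_zero he (by simp [adjInd, h])

variable [Fintype V]

/-- `l` bounds the operator norm of the centred (`±1`) adjacency matrix of `G`. -/
def CenteredNormLE (G : SimpleGraph V) (l : ℝ) : Prop :=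
  ∀ p q : V → ℝ, |∑ u, ∑ v, (2 * adjInd G u v - 1) * p u * q v|
    ≤ l * (√(∑ u, p u ^ 2) * √(∑ v, q v ^ 2))

variable [Fintype ι] [DecidableEq ι]

theorem card_mul_abs_sum_insert_le {G : SimpleGraph V} {l K : ℝ} (hl : 0 ≤ l)
    (hG : CenteredNormLE G l) {I J : Finset ι} {X Y : (ι → V) → ℝ}
    (hX : ∀ φ ψ, (∀ i ∈ I, φ i = ψ i) → X φ = X ψ)
    (hY : ∀ φ ψ, (∀ i ∈ J, φ i = ψ i) → Y φ = Y ψ)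
    (hXK : ∑ φ, X φ ^ 2 ≤ K) (hYK : ∑ φ, Y φ ^ 2 ≤ K)
    {H : Finset (ι × ι)} {a b : ι} (hab : a ≠ b) (ha : a ∉ J) (hb : b ∉ I)
    (h1 : (a, b) ∉ H) (h2 : (b, a) ∉ H) :
    (Fintype.card V : ℝ) * |∑ φ, X φ * Y φ * patternInd G (insert (a, b) H) φ
      - 1 / 2 * ∑ φ, X φ * Y φ * patternInd G H φ| ≤ l * K := by
  classical
  set H₁ := H.filter fun e => ¬ (e.1 = b ∨ e.2 = b)
  set H₂ := H.filter fun e => e.1 = b ∨ e.2 = b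
  have hK : 0 ≤ K := (Finset.sum_nonneg fun _ _ => sq_nonneg _).trans hXK
  have hsplit : ∀ φ, patternInd G H φ = patternInd G H₁ φ * patternInd G H₂ φ := fun φ => by
    unfold patternInd
    rw [mul_comm, Finset.prod_filter_mul_prod_filter_not]
  have hle : ∀ (H' : Finset (ι × ι)) (Z : (ι → V) → ℝ), ∑ φ, Z φ ^ 2 ≤ K →
      √(∑ φ, (Z φ * patternInd G H' φ) ^ 2) ≤ √K := fun H' Z hZ => by
    refine Real.sqrt_le_sqrt (le_trans (Finset.sum_le_sum fun φ _ => ?_) hZ)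
    rw [mul_pow]
    exact mul_le_of_le_one_right (sq_nonneg _)
      (pow_le_one₀ (patternInd_nonneg _ _ _) (patternInd_le_one _ _ _))
  have key := card_mul_abs_sum_kernel_le (fun u v => 2 * adjInd G u v - 1) hl hG hab
    (fun φ => X φ * patternInd G H₁ φ) (fun φ => Y φ * patternInd G H₂ φ)
    (fun φ v => by
      congr 1
      · exact hX _ _ fun i hi => Function.update_of_ne (ne_of_mem_of_not_mem hi hb) _ _
      · refine Finset.prod_congr rfl fun e he => ?_
        simp only [H₁, Finset.mem_filter, not_or] at he
        rw [Function.update_of_ne he.2.1, Function.update_of_ne he.2.2])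
    (fun φ u => by
      congr 1
      · exact hY _ _ fun i hi => Function.update_of_ne (ne_of_mem_of_not_mem hi ha) _ _
      · refine Finset.prod_congr rfl fun e he => ?_
        obtain ⟨c, d⟩ := e
        simp only [H₂, Finset.mem_filter] at he
        have hc : c ≠ a := by
          rintro rfl
          rcases he.2 with h | h
          · exact hab h
          · exact h1 (h ▸ he.1)
        have hd : d ≠ a := by
          rintro rfl
          rcases he.2 with h | h
          · exact h2 (h ▸ he.1)
          · exact hab h
        rw [Function.update_of_ne hc, Function.update_of_ne hd])
  have heq : ∑ φ, X φ * Y φ * patternInd G (insert (a, b) H) φ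
      - 1 / 2 * ∑ φ, X φ * Y φ * patternInd G H φ
      = 1 / 2 * ∑ φ, (2 * adjInd G (φ a) (φ b) - 1) * (X φ * patternInd G H₁ φ)
          * (Y φ * patternInd G H₂ φ) := by
    rw [Finset.mul_sum, Finset.mul_sum, ← Finset.sum_sub_distrib]
    refine Finset.sum_congr rfl fun φ _ => ?_
    have : patternInd G (insert (a, b) H) φ = adjInd G (φ a) (φ b) * patternInd G H φ := by
      unfold patternInd
      rw [Finset.prod_insert h1]
    rw [this, hsplit]
    ring
  rw [heq, abs_mul, abs_of_pos (by norm_num : (0 : ℝ) < 1 / 2)]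
  have h3 : l * (√(∑ φ, (X φ * patternInd G H₁ φ) ^ 2) * √(∑ φ, (Y φ * patternInd G H₂ φ) ^ 2))
      ≤ l * K := by
    refine mul_le_mul_of_nonneg_left ?_ hl
    calc _ ≤ √K * √K := mul_le_mul (hle _ _ hXK) (hle _ _ hYK) (Real.sqrt_nonneg _)
          (Real.sqrt_nonneg _)
      _ = K := Real.mul_self_sqrt hK
  have h4 : 0 ≤ l * K := mul_nonneg hl hK
  linarith

/-- Removing admissible pairs one at a time, each contributing a factor `1/2` up to an error. -/
theorem card_mul_abs_sum_union_le {G : SimpleGraph V} {l K : ℝ} (hl : 0 ≤ l)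
    (hG : CenteredNormLE G l) {I J : Finset ι} {X Y : (ι → V) → ℝ}
    (hX : ∀ φ ψ, (∀ i ∈ I, φ i = ψ i) → X φ = X ψ)
    (hY : ∀ φ ψ, (∀ i ∈ J, φ i = ψ i) → Y φ = Y ψ)
    (hXK : ∑ φ, X φ ^ 2 ≤ K) (hYK : ∑ φ, Y φ ^ 2 ≤ K)
    (H E : Finset (ι × ι))
    (hE : ∀ e ∈ E, e.1 ≠ e.2 ∧ e.1 ∉ J ∧ e.2 ∉ I ∧ e ∉ H ∧ e.swap ∉ H ∧ e.swap ∉ E) :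
    (Fintype.card V : ℝ) * |∑ φ, X φ * Y φ * patternInd G (E ∪ H) φ
      - (1 / 2) ^ #E * ∑ φ, X φ * Y φ * patternInd G H φ| ≤ #E * (l * K) := by
  classical
  have hK : 0 ≤ l * K := mul_nonneg hl ((Finset.sum_nonneg fun _ _ => sq_nonneg _).trans hXK)
  induction E using Finset.induction_on with
  | empty => simp
  | insert e E he ih =>
    have hE' : ∀ e' ∈ E, e'.1 ≠ e'.2 ∧ e'.1 ∉ J ∧ e'.2 ∉ I ∧ e' ∉ H ∧ e'.swap ∉ H
        ∧ e'.swap ∉ E := fun e' he' => by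
      obtain ⟨h1, h2, h3, h4, h5, h6⟩ := hE e' (Finset.mem_insert_of_mem he')
      exact ⟨h1, h2, h3, h4, h5, fun h => h6 (Finset.mem_insert_of_mem h)⟩
    specialize ih hE'
    obtain ⟨h1, h2, h3, h4, h5, h6⟩ := hE e (Finset.mem_insert_self _ _)
    have step := card_mul_abs_sum_insert_le hl hG hX hY hXK hYK (H := E ∪ H) h1 h2 h3
      (by simp [he, h4])
      (by
        intro h
        rcases Finset.mem_union.1 h with h | h
        · exact h6 (Finset.mem_insert_of_mem h)
        · exact h5 h)
    rw [Finset.card_insert_of_notMem he, Finset.insert_union, pow_succ]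
    push_cast
    set n : ℝ := (Fintype.card V : ℝ)
    have hn : 0 ≤ n := Nat.cast_nonneg _
    set a := ∑ φ, X φ * Y φ * patternInd G (insert e (E ∪ H)) φ
    set b := ∑ φ, X φ * Y φ * patternInd G (E ∪ H) φ
    set c := ∑ φ, X φ * Y φ * patternInd G H φ
    have h7 : |a - (1 / 2) ^ #E * (1 / 2) * c|
        ≤ |a - 1 / 2 * b| + 1 / 2 * |b - (1 / 2) ^ #E * c| := by
      rw [show a - (1 / 2) ^ #E * (1 / 2) * c
        = (a - 1 / 2 * b) + 1 / 2 * (b - (1 / 2) ^ #E * c) by ring]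
      refine (abs_add_le _ _).trans ?_
      rw [abs_mul, abs_of_pos (by norm_num : (0 : ℝ) < 1 / 2)]
    have h8 := mul_le_mul_of_nonneg_left h7 hn
    have h9 : (0 : ℝ) ≤ #E * (l * K) := by positivity
    have step' : n * |a - 1 / 2 * b| ≤ l * K := step
    nlinarith

variable [DecidableEq V]

theorem exists_perm_image_eq {A B : Finset ι} (h : #A = #B) :
    ∃ σ : Equiv.Perm ι, A.image σ = B := by
  classical
  let e : {x // x ∈ A} ≃ {x // x ∈ B} := Finset.equivOfCardEq h
  refine ⟨e.extendSubtype, Finset.eq_of_subset_of_card_le ?_ ?_⟩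
  · intro j hj
    obtain ⟨i, hi, rfl⟩ := Finset.mem_image.1 hj
    exact e.extendSubtype_mem i hi
  · rw [Finset.card_image_of_injective _ (Equiv.injective _), h]

theorem sum_image_eq_of_card_eq {A B : Finset ι} (h : #A = #B) (f : Finset V → ℝ) :
    ∑ φ : ι → V, f (A.image φ) = ∑ φ : ι → V, f (B.image φ) := by
  classical
  obtain ⟨σ, rfl⟩ := exists_perm_image_eq h
  rw [← Equiv.sum_comp (σ.symm.arrowCongr (Equiv.refl V))]
  refine Finset.sum_congr rfl fun φ _ => ?_
  rw [Finset.image_image]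
  congr 1

/-- The sum over patterns in which only the pairs between `I ∩ J` and the complement of `I ∪ J`
are constrained is nonnegative, being a weighted sum of squares. -/
theorem sum_patternInd_inter_nonneg [Nonempty V] (G : SimpleGraph V) {I J : Finset ι}
    (h : #I = #J) (x : Finset V → ℝ) :
    0 ≤ ∑ φ : ι → V, x (I.image φ) * x (J.image φ)
      * patternInd G ((I ∩ J) ×ˢ (I ∪ J)ᶜ) φ := by
  classical
  set S := I ∩ J
  set A := I \ J
  set B := J \ I
  have hAB : #A = #B := Finset.card_sdiff_comm h
  have hN : (0 : ℝ) < (Fintype.card V : ℝ) ^ Fintype.card ι := by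
    have : 0 < Fintype.card V := Fintype.card_pos
    positivity
  refine nonneg_of_mul_nonneg_right ?_ hN
  rw [← sum_sum_piecewise (A ∪ B)]
  refine Finset.sum_nonneg fun φ _ => ?_
  have himI : ∀ ψ : ι → V, I.image ((A ∪ B).piecewise ψ φ) = S.image φ ∪ A.image ψ := fun ψ => by
    have : I = S ∪ A := by ext i; simp [S, A]; tauto
    rw [this, Finset.image_union]
    congr 1 <;> refine Finset.image_congr fun i hi => ?_
    · have : i ∉ A ∪ B := by simp [S, A, B] at hi ⊢; tauto
      simp only [Finset.piecewise_eq_of_notMem _ _ _ this]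
    · simp only [Finset.piecewise_eq_of_mem _ _ _ (Finset.mem_union_left B hi)]
  have himJ : ∀ ψ : ι → V, J.image ((A ∪ B).piecewise ψ φ) = S.image φ ∪ B.image ψ := fun ψ => by
    have : J = S ∪ B := by ext i; simp [S, B]; tauto
    rw [this, Finset.image_union]
    congr 1 <;> refine Finset.image_congr fun i hi => ?_
    · have : i ∉ A ∪ B := by simp [S, A, B] at hi ⊢; tauto
      simp only [Finset.piecewise_eq_of_notMem _ _ _ this]
    · simp only [Finset.piecewise_eq_of_mem _ _ _ (Finset.mem_union_right A hi)]
  have hpat : ∀ ψ : ι → V, patternInd G (S ×ˢ (I ∪ J)ᶜ) ((A ∪ B).piecewise ψ φ)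
      = patternInd G (S ×ˢ (I ∪ J)ᶜ) φ := fun ψ => by
    refine Finset.prod_congr rfl fun e he => ?_
    have h1 : e.1 ∉ A ∪ B := by simp [S, A, B] at he ⊢; tauto
    have h2 : e.2 ∉ A ∪ B := by simp [S, A, B] at he ⊢; tauto
    rw [Finset.piecewise_eq_of_notMem _ _ _ h1, Finset.piecewise_eq_of_notMem _ _ _ h2]
  simp_rw [himI, himJ, hpat]
  rw [← Finset.sum_mul]
  refine mul_nonneg (nonneg_of_mul_nonneg_right ?_ hN) (patternInd_nonneg _ _ _)
  rw [card_pow_mul_sum_mul A, sum_image_eq_of_card_eq hAB (fun U => x (S.image φ ∪ U))]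
  · exact mul_self_nonneg _
  · intro ψ ψ' hψ
    rw [Finset.image_congr (s := A) hψ]
  · intro ψ ψ' hψ
    rw [Finset.image_congr (s := B) (g := ψ') fun i hi => hψ i (by simp [A, B] at hi ⊢; tauto)]

/-- If every set in the support of `x` of the size of `I` has at least `c |V|` common neighbours,
then the diagonal sum is bounded below. -/
theorem le_sum_patternInd_compl [Nonempty V] (G : SimpleGraph V) (I : Finset ι)
    (x : Finset V → ℝ) {c : ℝ} (hc : 0 ≤ c)
    (hx : ∀ U, x U ≠ 0 → c * Fintype.card V ≤ ∑ v, ∏ u ∈ U, adjInd G u v)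
    (hcard : ∀ U, x U ≠ 0 → #U = #I) :
    c ^ #Iᶜ * ∑ φ : ι → V, x (I.image φ) ^ 2
      ≤ ∑ φ : ι → V, x (I.image φ) * x (I.image φ) * patternInd G (I ×ˢ Iᶜ) φ := by
  classical
  set n : ℝ := (Fintype.card V : ℝ)
  have hn : 0 < n := by
    simp only [n, Nat.cast_pos]
    exact Fintype.card_pos
  have hN : 0 < n ^ Fintype.card ι := by positivity
  refine le_of_mul_le_mul_left ?_ hN
  rw [← sum_sum_piecewise Iᶜ, Finset.mul_sum, Finset.mul_sum]
  refine Finset.sum_le_sum fun φ _ => ?_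
  have him : ∀ ψ : ι → V, I.image (Iᶜ.piecewise ψ φ) = I.image φ := fun ψ =>
    Finset.image_congr fun i hi => Finset.piecewise_eq_of_notMem _ _ _ (by simpa using hi)
  have hpat : ∀ ψ : ι → V, patternInd G (I ×ˢ Iᶜ) (Iᶜ.piecewise ψ φ)
      = ∏ j, if j ∈ Iᶜ then ∏ i ∈ I, adjInd G (φ i) (ψ j) else 1 := fun ψ => by
    unfold patternInd
    rw [Finset.prod_product_right, Finset.prod_ite_mem, Finset.univ_inter]
    refine Finset.prod_congr rfl fun j hj => Finset.prod_congr rfl fun i hi => ?_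
    rw [Finset.piecewise_eq_of_mem _ _ _ hj, Finset.piecewise_eq_of_notMem _ _ _ (by simpa using hi)]
  simp_rw [him, hpat]
  rw [← Finset.mul_sum]
  have hprod : ∑ ψ : ι → V, ∏ j, (if j ∈ Iᶜ then ∏ i ∈ I, adjInd G (φ i) (ψ j) else 1)
      = (∑ v, ∏ i ∈ I, adjInd G (φ i) v) ^ #Iᶜ * n ^ #I := by
    have := Finset.prod_univ_sum (fun _ : ι => (Finset.univ : Finset V))
      (fun j v => if j ∈ Iᶜ then ∏ i ∈ I, adjInd G (φ i) v else 1)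
    rw [Fintype.piFinset_univ] at this
    rw [← this, ← Finset.prod_mul_prod_compl Iᶜ, compl_compl]
    congr 1
    · rw [← Finset.prod_const]
      exact Finset.prod_congr rfl fun j hj => by simp only [hj, if_true]
    · rw [← Finset.prod_const]
      exact Finset.prod_congr rfl fun j hj => by simp [hj, n]
  rw [hprod]
  by_cases h0 : x (I.image φ) = 0
  · simp [h0]
  have hinj : Set.InjOn φ I := Finset.card_image_iff.1 (hcard _ h0)
  have h1 := hx _ h0
  rw [Finset.sum_congr rfl fun v _ => Finset.prod_image (f := fun u => adjInd G u v) hinj] at h1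
  have h2 : (c * n) ^ #Iᶜ ≤ (∑ v, ∏ i ∈ I, adjInd G (φ i) v) ^ #Iᶜ :=
    pow_le_pow_left₀ (by positivity) h1 _
  have h3 : n ^ Fintype.card ι = n ^ #Iᶜ * n ^ #I := by
    rw [← pow_add, Finset.card_compl_add_card]
  rw [h3]
  calc _ = x (I.image φ) * x (I.image φ) * ((c * n) ^ #Iᶜ * n ^ #I) := by rw [mul_pow]; ring
    _ ≤ _ := mul_le_mul_of_nonneg_left
      (mul_le_mul_of_nonneg_right h2 (by positivity)) (mul_self_nonneg _)

end PatternSum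

section CliqueMoment

variable {V : Type*} [Fintype V] [DecidableEq V]

/-- The pairs that are neither inside `I`, nor inside `J`, nor between `I ∩ J` and the complement
of `I ∪ J`; each unordered pair is listed once. -/
def crossingPairs {m : ℕ} (I J : Finset (Fin m)) : Finset (Fin m × Fin m) :=
  Finset.univ.filter fun e => e.1 ≠ e.2 ∧ e.1 ∉ J ∧ e.2 ∉ I ∧ (e.1 ∉ I → e.2 ∉ J → e.1 < e.2)

theorem card_crossingPairs_le {m : ℕ} (I J : Finset (Fin m)) : #(crossingPairs I J) ≤ m ^ 2 := by
  refine (Finset.card_le_univ _).trans ?_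
  simp [pow_two]

theorem crossingPairs_admissible {m : ℕ} (I J : Finset (Fin m)) :
    ∀ e ∈ crossingPairs I J, e.1 ≠ e.2 ∧ e.1 ∉ J ∧ e.2 ∉ I ∧ e ∉ (I ∩ J) ×ˢ (I ∪ J)ᶜ
      ∧ e.swap ∉ (I ∩ J) ×ˢ (I ∪ J)ᶜ ∧ e.swap ∉ crossingPairs I J := by
  rintro ⟨a, b⟩ he
  simp only [crossingPairs, Finset.mem_filter, Finset.mem_univ, true_and] at he
  simp only [crossingPairs, Finset.mem_filter, Finset.mem_univ, true_and, Prod.swap,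
    Finset.mem_product, Finset.mem_inter, Finset.mem_compl, Finset.mem_union]
  refine ⟨he.1, he.2.1, he.2.2.1, fun h => he.2.1 h.1.2, fun h => he.2.2.1 h.1.1, ?_⟩
  rintro ⟨-, h2, h3, h4⟩
  exact absurd (he.2.2.2 h3 h2) (not_lt.2 (h4 he.2.2.1 he.2.1).le)

/-- The tuple `φ` enumerates a clique of `G` without repetition. -/
def IsCliqueTuple {m : ℕ} (G : SimpleGraph V) (φ : Fin m → V) : Prop :=
  ∀ a b, a ≠ b → G.Adj (φ a) (φ b)

omit [Fintype V] [DecidableEq V] in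
theorem IsCliqueTuple.injective {m : ℕ} {G : SimpleGraph V} {φ : Fin m → V}
    (h : IsCliqueTuple G φ) : Function.Injective φ := fun a b hab => by
  by_contra hne
  exact G.ne_of_adj (h a b hne) hab

open scoped Classical in
/-- The restriction of `Z` to the cliques of `G` with `r` vertices. -/
noncomputable def restrictCliques (G : SimpleGraph V) (r : ℕ) (Z : Finset V → ℝ)
    (U : Finset V) : ℝ := if G.IsNClique r U then Z U else 0

omit [Fintype V] in
theorem isNClique_of_restrictCliques_ne_zero {G : SimpleGraph V} {r : ℕ} {Z : Finset V → ℝ}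
    {U : Finset V} (h : restrictCliques G r Z U ≠ 0) : G.IsNClique r U := by
  by_contra hU
  exact h (by simp [restrictCliques, hU])

omit [Fintype V] in
open scoped Classical in
theorem ite_isCliqueTuple_eq {m r : ℕ} (G : SimpleGraph V) (Z : Finset V → ℝ)
    {I J : Finset (Fin m)} (hI : #I = r) (hJ : #J = r) (φ : Fin m → V) :
    (if IsCliqueTuple G φ then Z (I.image φ) * Z (J.image φ) else 0)
      = restrictCliques G r Z (I.image φ) * restrictCliques G r Z (J.image φ)
        * patternInd G (crossingPairs I J ∪ (I ∩ J) ×ˢ (I ∪ J)ᶜ) φ := by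
  by_cases hφ : IsCliqueTuple G φ
  · have hcl : ∀ {A : Finset (Fin m)}, #A = r → G.IsNClique r (A.image φ) := fun {A} hA => by
      refine ⟨?_, by rw [Finset.card_image_of_injective _ hφ.injective, hA]⟩
      intro u hu v hv huv
      obtain ⟨a, -, rfl⟩ := Finset.mem_image.1 (Finset.mem_coe.1 hu)
      obtain ⟨b, -, rfl⟩ := Finset.mem_image.1 (Finset.mem_coe.1 hv)
      exact hφ a b fun h => huv (h ▸ rfl)
    rw [patternInd_eq_one, if_pos hφ, restrictCliques, restrictCliques, if_pos (hcl hI),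
      if_pos (hcl hJ), mul_one]
    rintro ⟨a, b⟩ he
    refine hφ a b ?_
    rintro rfl
    simp [crossingPairs] at he
    tauto
  · rw [if_neg hφ]
    by_contra hne
    have hne' := Ne.symm hne
    have h1 : G.IsNClique r (I.image φ) := isNClique_of_restrictCliques_ne_zero (Z := Z)
      (left_ne_zero_of_mul (left_ne_zero_of_mul hne'))
    have h2 : G.IsNClique r (J.image φ) := isNClique_of_restrictCliques_ne_zero (Z := Z)
      (right_ne_zero_of_mul (left_ne_zero_of_mul hne'))
    have h3 := right_ne_zero_of_mul hne'
    have hadj : ∀ e ∈ crossingPairs I J ∪ (I ∩ J) ×ˢ (I ∪ J)ᶜ, G.Adj (φ e.1) (φ e.2) :=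
      fun e he => by
        by_contra h
        exact h3 (patternInd_eq_zero he h)
    have hin : ∀ {A : Finset (Fin m)}, #A = r → G.IsNClique r (A.image φ) →
        ∀ a ∈ A, ∀ b ∈ A, a ≠ b → G.Adj (φ a) (φ b) := fun {A} hA hcl a ha b hb hab => by
      have hinj : Set.InjOn φ A := Finset.card_image_iff.1 (hcl.2.trans hA.symm)
      exact hcl.1 (by simpa using ⟨a, ha, rfl⟩) (by simpa using ⟨b, hb, rfl⟩)
        fun h => hab (hinj ha hb h)
    refine hφ fun a b hab => ?_
    have hI' := hin hI h1 a
    have hJ' := hin hJ h2 a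
    have e1 := hadj (a, b)
    have e2 := hadj (b, a)
    simp only [crossingPairs, Finset.mem_union, Finset.mem_filter, Finset.mem_univ, true_and,
      Finset.mem_product, Finset.mem_inter, Finset.mem_compl] at e1 e2
    rcases lt_or_gt_of_ne hab with hlt | hlt <;>
    by_cases a1 : a ∈ I <;> by_cases a2 : a ∈ J <;> by_cases b1 : b ∈ I <;> by_cases b2 : b ∈ J <;>
    first
    | exact hI' a1 b b1 hab
    | exact hJ' a2 b b2 hab
    | (refine e1 ?_; simp [a1, a2, b1, b2, hab, hlt]; done)
    | (refine (e2 ?_).symm; simp [a1, a2, b1, b2, hab.symm, hlt])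

open scoped Classical in
/-- The moment of the pseudo-distribution at the monomial `∏ i ∈ U, x i`, up to normalization:
the number of ordered `2r`-cliques containing `U`, times `choose k |U| / choose (2r) |U|`. -/
noncomputable def cliqueMoment (G : SimpleGraph V) (r k : ℕ) (U : Finset V) : ℝ :=
  ((k.choose #U : ℝ) / ((2 * r).choose #U : ℝ)) *
    ∑ φ : Fin (2 * r) → V, if IsCliqueTuple G φ ∧ U ⊆ Finset.univ.image φ then 1 else 0

theorem cliqueMoment_marginal (G : SimpleGraph V) {r k : ℕ} (hk : 2 * r ≤ k) {U : Finset V}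
    (hU : #U < 2 * r) :
    ∑ i, cliqueMoment G r k (insert i U) = k * cliqueMoment G r k U := by
  classical
  have h1 : ∀ φ : Fin (2 * r) → V,
      ∑ i ∈ Uᶜ, (if IsCliqueTuple G φ ∧ insert i U ⊆ Finset.univ.image φ then (1 : ℝ) else 0)
      = ((2 * r : ℕ) - #U : ℝ)
        * if IsCliqueTuple G φ ∧ U ⊆ Finset.univ.image φ then (1 : ℝ) else 0 := fun φ => by
    by_cases h : IsCliqueTuple G φ ∧ U ⊆ Finset.univ.image φ
    · rw [if_pos h, ← Finset.sum_filter, Finset.sum_const, nsmul_one, mul_one]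
      have : (Uᶜ.filter fun i => IsCliqueTuple G φ ∧ insert i U ⊆ Finset.univ.image φ)
          = Finset.univ.image φ \ U := by
        ext i
        simp only [Finset.mem_filter, Finset.mem_compl, Finset.insert_subset_iff,
          Finset.mem_sdiff, h.1, h.2, and_true, true_and]
        tauto
      rw [this, Finset.card_sdiff_of_subset h.2, Finset.card_image_of_injective _ h.1.injective,
        Finset.card_univ, Fintype.card_fin, Nat.cast_sub hU.le]
    · rw [if_neg h, mul_zero]
      refine Finset.sum_eq_zero fun i _ => if_neg fun h' => h ⟨h'.1, ?_⟩
      exact (Finset.subset_insert _ _).trans h'.2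
  have h2 : ((k.choose (#U + 1) : ℝ) / ((2 * r).choose (#U + 1) : ℝ)) * ((2 * r : ℕ) - #U : ℝ)
      = ((k.choose #U : ℝ) / ((2 * r).choose #U : ℝ)) * (k - #U) := by
    have e1 : (k.choose (#U + 1) : ℝ) * (#U + 1) = k.choose #U * (k - #U) := by
      rw [← Nat.cast_sub (by omega)]
      exact_mod_cast Nat.choose_succ_right_eq k #U
    have e2 : ((2 * r).choose (#U + 1) : ℝ) * (#U + 1) = (2 * r).choose #U * ((2 * r : ℕ) - #U) := by
      rw [← Nat.cast_sub hU.le]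
      exact_mod_cast Nat.choose_succ_right_eq (2 * r) #U
    have p1 : (0 : ℝ) < (2 * r).choose (#U + 1) := by exact_mod_cast Nat.choose_pos (by omega)
    have p2 : (0 : ℝ) < (2 * r).choose #U := by exact_mod_cast Nat.choose_pos hU.le
    have p3 : (0 : ℝ) < (#U : ℝ) + 1 := by positivity
    rw [div_mul_eq_mul_div, div_mul_eq_mul_div, div_eq_div_iff p1.ne' p2.ne']
    refine mul_right_cancel₀ p3.ne' ?_
    linear_combination ((2 * r : ℕ) - (#U : ℝ)) * ((2 * r).choose #U : ℝ) * e1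
      - (k.choose #U : ℝ) * (k - #U) * e2
  rw [← Finset.sum_add_sum_compl U]
  have h3 : ∑ i ∈ U, cliqueMoment G r k (insert i U) = #U * cliqueMoment G r k U := by
    rw [Finset.sum_congr rfl fun i hi => by rw [Finset.insert_eq_of_mem hi]]
    simp
  have h4 : ∑ i ∈ Uᶜ, cliqueMoment G r k (insert i U) = (k - #U) * cliqueMoment G r k U := by
    unfold cliqueMoment
    rw [Finset.sum_congr rfl fun i hi => by
      rw [Finset.card_insert_of_notMem (Finset.mem_compl.1 hi)], ← Finset.mul_sum,
      Finset.sum_comm, Finset.sum_congr rfl fun φ _ => h1 φ, ← Finset.mul_sum, ← mul_assoc, h2]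
    ring
  rw [h3, h4]
  ring

theorem cliqueMoment_eq_zero (G : SimpleGraph V) (r k : ℕ) {U : Finset V} {i j : V} (hi : i ∈ U)
    (hj : j ∈ U) (hij : i ≠ j) (h : ¬ G.Adj i j) : cliqueMoment G r k U = 0 := by
  classical
  unfold cliqueMoment
  rw [Finset.sum_eq_zero, mul_zero]
  refine fun φ _ => if_neg fun hφ => h ?_
  obtain ⟨a, -, rfl⟩ := Finset.mem_image.1 (hφ.2 hi)
  obtain ⟨b, -, rfl⟩ := Finset.mem_image.1 (hφ.2 hj)
  exact hφ.1 a b fun hab => hij (hab ▸ rfl)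

theorem cliqueMoment_empty_pos {G : SimpleGraph V} {r k : ℕ} {φ : Fin (2 * r) → V}
    (hφ : IsCliqueTuple G φ) : 0 < cliqueMoment G r k ∅ := by
  classical
  unfold cliqueMoment
  simp only [Finset.card_empty, Nat.choose_zero_right, Nat.cast_one, div_one, one_mul,
    Finset.empty_subset, and_true]
  exact Finset.sum_pos' (fun _ _ => by split_ifs <;> norm_num) ⟨φ, Finset.mem_univ _, by simp [hφ]⟩

open scoped Classical in
theorem sum_cliqueMoment_union_eq (G : SimpleGraph V) (r k : ℕ) (Z : Finset V → ℝ) :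
    ∑ I ∈ Finset.univ.powersetCard r, ∑ J ∈ Finset.univ.powersetCard r,
      Z I * Z J * cliqueMoment G r k (I ∪ J)
    = ∑ I ∈ (Finset.univ : Finset (Fin (2 * r))).powersetCard r,
        ∑ J ∈ (Finset.univ : Finset (Fin (2 * r))).powersetCard r,
          ((k.choose #(I ∪ J) : ℝ) / ((2 * r).choose #(I ∪ J) : ℝ)) *
            ∑ φ : Fin (2 * r) → V,
              if IsCliqueTuple G φ then Z (I.image φ) * Z (J.image φ) else 0 := by
  let al : ℕ → ℝ := fun s => (k.choose s : ℝ) / ((2 * r).choose s : ℝ)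
  have hL : ∑ I ∈ Finset.univ.powersetCard r, ∑ J ∈ Finset.univ.powersetCard r,
      Z I * Z J * cliqueMoment G r k (I ∪ J)
      = ∑ φ : Fin (2 * r) → V, ∑ I ∈ Finset.univ.powersetCard r, ∑ J ∈ Finset.univ.powersetCard r,
        if IsCliqueTuple G φ ∧ I ∪ J ⊆ Finset.univ.image φ then Z I * Z J * al #(I ∪ J) else 0 := by
    rw [Finset.sum_comm (s := (Finset.univ : Finset (Fin (2 * r) → V)))]
    refine Finset.sum_congr rfl fun I _ => ?_
    rw [Finset.sum_comm (s := (Finset.univ : Finset (Fin (2 * r) → V)))]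
    refine Finset.sum_congr rfl fun J _ => ?_
    rw [cliqueMoment, ← mul_assoc, Finset.mul_sum]
    exact Finset.sum_congr rfl fun φ _ => by rw [mul_ite, mul_one, mul_zero]
  have hR : ∑ I ∈ (Finset.univ : Finset (Fin (2 * r))).powersetCard r,
        ∑ J ∈ (Finset.univ : Finset (Fin (2 * r))).powersetCard r,
          al #(I ∪ J) * ∑ φ : Fin (2 * r) → V,
              (if IsCliqueTuple G φ then Z (I.image φ) * Z (J.image φ) else 0)
      = ∑ φ : Fin (2 * r) → V, ∑ I ∈ (Finset.univ : Finset (Fin (2 * r))).powersetCard r,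
        ∑ J ∈ (Finset.univ : Finset (Fin (2 * r))).powersetCard r,
          if IsCliqueTuple G φ then Z (I.image φ) * Z (J.image φ) * al #(I ∪ J) else 0 := by
    rw [Finset.sum_comm (s := (Finset.univ : Finset (Fin (2 * r) → V)))]
    refine Finset.sum_congr rfl fun I _ => ?_
    rw [Finset.sum_comm (s := (Finset.univ : Finset (Fin (2 * r) → V)))]
    refine Finset.sum_congr rfl fun J _ => ?_
    rw [Finset.mul_sum]
    exact Finset.sum_congr rfl fun φ _ => by split_ifs <;> ring
  rw [hL, hR]
  refine Finset.sum_congr rfl fun φ _ => ?_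
  by_cases hφ : IsCliqueTuple G φ
  · simp only [hφ, true_and, if_true]
    have hsub : ∀ F : Finset V → ℝ, (∀ I, ¬ I ⊆ Finset.univ.image φ → F I = 0) →
        ∑ I ∈ Finset.univ.powersetCard r, F I
        = ∑ I ∈ (Finset.univ : Finset (Fin (2 * r))).powersetCard r, F (I.image φ) := by
      intro F hF
      let e : Fin (2 * r) ↪ V := ⟨φ, hφ.injective⟩
      have h1 : ∀ I : Finset (Fin (2 * r)), I.image φ = I.map e := fun I =>
        (Finset.map_eq_image e I).symm
      have h2 : ∑ I ∈ (Finset.univ : Finset (Fin (2 * r))).powersetCard r, F (I.image φ)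
          = ∑ I ∈ (Finset.univ.image φ).powersetCard r, F I := by
        rw [h1, Finset.powersetCard_map, Finset.sum_map]
        exact Finset.sum_congr rfl fun I _ => by rw [h1]; rfl
      rw [h2]
      symm
      refine Finset.sum_subset (Finset.powersetCard_mono (Finset.subset_univ _)) fun I hI hI' => ?_
      refine hF I fun h => hI' ?_
      rw [Finset.mem_powersetCard] at hI ⊢
      exact ⟨h, hI.2⟩
    rw [hsub]
    · refine Finset.sum_congr rfl fun I _ => ?_
      rw [hsub]
      · refine Finset.sum_congr rfl fun J _ => ?_
        rw [← Finset.image_union, if_pos (Finset.image_subset_image (Finset.subset_univ _)),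
          Finset.card_image_of_injective _ hφ.injective]
      · exact fun J hJ => if_neg fun h => hJ (Finset.union_subset_iff.1 h).2
    · exact fun I hI => Finset.sum_eq_zero fun J _ =>
        if_neg fun h => hI (Finset.union_subset_iff.1 h).1
  · simp [hφ]

end CliqueMoment

section Positivity

variable {V : Type*} [Fintype V] [DecidableEq V]

theorem sum_cliqueMoment_union_nonneg [Nonempty V] {G : SimpleGraph V} {r k : ℕ} (hk : 1 ≤ k)
    {l c : ℝ} (hl : 0 ≤ l) (hc : 0 ≤ c) (hG : CenteredNormLE G l)
    (hN : ∀ U, G.IsNClique r U → c * Fintype.card V ≤ ∑ v, ∏ u ∈ U, adjInd G u v)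
    (hnum : 4 ^ r * ((k : ℝ) ^ (2 * r) * ((2 * r : ℕ) ^ 2 * l))
      ≤ (Fintype.card V : ℝ) * ((k.choose r : ℝ) / ((2 * r).choose r : ℝ)
        * ((1 / 2) ^ ((2 * r) ^ 2) * c ^ r)))
    (Z : Finset V → ℝ) :
    0 ≤ ∑ I ∈ Finset.univ.powersetCard r, ∑ J ∈ Finset.univ.powersetCard r,
      Z I * Z J * cliqueMoment G r k (I ∪ J) := by
  classical
  rw [sum_cliqueMoment_union_eq]
  set n : ℝ := (Fintype.card V : ℝ) with hn
  set P := (Finset.univ : Finset (Fin (2 * r))).powersetCard r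
  have hn0 : 0 < n := by rw [hn]; exact_mod_cast Fintype.card_pos
  set x := restrictCliques G r Z
  have hPcard : (#P : ℝ) ≤ 4 ^ r := by
    have : #P ≤ 4 ^ r := by
      rw [Finset.card_powersetCard, Finset.card_univ, Fintype.card_fin]
      refine (Nat.choose_le_two_pow _ _).trans_eq ?_
      rw [pow_mul]; norm_num
    exact_mod_cast this
  obtain ⟨I₀, hI₀⟩ : ∃ I₀ : Finset (Fin (2 * r)), #I₀ = r := by
    obtain ⟨I₀, -, h⟩ := Finset.exists_subset_card_eq
      (s := (Finset.univ : Finset (Fin (2 * r)))) (n := r) (by simp; omega)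
    exact ⟨I₀, h⟩
  set K := ∑ φ : Fin (2 * r) → V, x (I₀.image φ) ^ 2 with hKdef
  have hK : 0 ≤ K := Finset.sum_nonneg fun _ _ => sq_nonneg _
  have hKI : ∀ I : Finset (Fin (2 * r)), #I = r →
      ∑ φ : Fin (2 * r) → V, x (I.image φ) ^ 2 = K := fun I hI =>
    sum_image_eq_of_card_eq (hI.trans hI₀.symm) fun U => x U ^ 2
  set err : ℝ := (k : ℝ) ^ (2 * r) * ((2 * r : ℕ) ^ 2 * l)
  set main : ℝ := (k.choose r : ℝ) / ((2 * r).choose r : ℝ) * ((1 / 2) ^ ((2 * r) ^ 2) * c ^ r)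
  have hpair : ∀ I ∈ P, ∀ J ∈ P, (if I = J then n * main * K else 0) - err * K
      ≤ n * (((k.choose #(I ∪ J) : ℝ) / ((2 * r).choose #(I ∪ J) : ℝ)) *
            ∑ φ : Fin (2 * r) → V,
              if IsCliqueTuple G φ then Z (I.image φ) * Z (J.image φ) else 0) := by
    intro I hI J hJ
    rw [Finset.mem_powersetCard_univ] at hI hJ
    rw [Finset.sum_congr rfl fun φ _ => ite_isCliqueTuple_eq G Z hI hJ φ]
    have hcross := card_mul_abs_sum_union_le hl hG (I := I) (J := J)
      (X := fun φ => x (I.image φ)) (Y := fun φ => x (J.image φ))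
      (fun φ ψ h => by simp only [Finset.image_congr h])
      (fun φ ψ h => by simp only [Finset.image_congr h])
      (hKI I hI).le (hKI J hJ).le _ _ (crossingPairs_admissible I J)
    set T := ∑ φ : Fin (2 * r) → V, x (I.image φ) * x (J.image φ)
      * patternInd G (crossingPairs I J ∪ (I ∩ J) ×ˢ (I ∪ J)ᶜ) φ
    set S := ∑ φ : Fin (2 * r) → V, x (I.image φ) * x (J.image φ)
      * patternInd G ((I ∩ J) ×ˢ (I ∪ J)ᶜ) φ with hS
    set q : ℝ := (1 / 2) ^ #(crossingPairs I J)
    have hE : (#(crossingPairs I J) : ℝ) ≤ (2 * r : ℕ) ^ 2 := by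
      exact_mod_cast card_crossingPairs_le I J
    have hq : (1 / 2 : ℝ) ^ ((2 * r) ^ 2) ≤ q :=
      pow_le_pow_of_le_one (by norm_num) (by norm_num) (card_crossingPairs_le I J)
    have hS0 : 0 ≤ S := sum_patternInd_inter_nonneg G (hI.trans hJ.symm) x
    have hlow : n * (q * S) - (2 * r : ℕ) ^ 2 * (l * K) ≤ n * T := by
      have h1 : n * (q * S - T) ≤ #(crossingPairs I J) * (l * K) := by
        refine le_trans (mul_le_mul_of_nonneg_left ?_ hn0.le) hcross
        rw [abs_sub_comm]; exact le_abs_self _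
      have h2 : (#(crossingPairs I J) : ℝ) * (l * K) ≤ (2 * r : ℕ) ^ 2 * (l * K) :=
        mul_le_mul_of_nonneg_right hE (mul_nonneg hl hK)
      linarith
    set al : ℝ := (k.choose #(I ∪ J) : ℝ) / ((2 * r).choose #(I ∪ J) : ℝ) with hal
    have hal0 : 0 ≤ al := by positivity
    have halk : al ≤ (k : ℝ) ^ (2 * r) := by
      have hs : #(I ∪ J) ≤ 2 * r := (Finset.card_le_univ _).trans_eq (Fintype.card_fin _)
      have h1 : (1 : ℝ) ≤ ((2 * r).choose #(I ∪ J) : ℝ) := by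
        exact_mod_cast Nat.choose_pos hs
      refine (div_le_self (by positivity) h1).trans ?_
      exact_mod_cast (Nat.choose_le_pow _ _).trans (Nat.pow_le_pow_right hk hs)
    have h3 : al * ((2 * r : ℕ) ^ 2 * (l * K)) ≤ err * K := by
      calc al * ((2 * r : ℕ) ^ 2 * (l * K)) ≤ (k : ℝ) ^ (2 * r) * ((2 * r : ℕ) ^ 2 * (l * K)) :=
            mul_le_mul_of_nonneg_right halk (by positivity)
        _ = err * K := by simp only [err]; ring
    have h4 : (if I = J then n * main * K else 0) ≤ al * (n * (q * S)) := by
      split_ifs with hIJ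
      · subst hIJ
        have h5 : c ^ r * K ≤ S := by
          have h := le_sum_patternInd_compl G I x hc
            (fun U hU => hN U (isNClique_of_restrictCliques_ne_zero hU))
            (fun U hU => (isNClique_of_restrictCliques_ne_zero hU).2.trans hI.symm)
          rw [hKI I hI, Finset.card_compl, Fintype.card_fin, hI,
            show 2 * r - r = r by omega] at h
          rw [hS, Finset.inter_self, Finset.union_self]
          exact h
        rw [Finset.union_self, hI] at hal
        calc n * main * K = al * (n * ((1 / 2 : ℝ) ^ ((2 * r) ^ 2) * (c ^ r * K))) := by
              simp only [main, hal]; ring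
          _ ≤ al * (n * (q * S)) := by gcongr
      · positivity
    calc _ ≤ al * (n * (q * S)) - al * ((2 * r : ℕ) ^ 2 * (l * K)) := by linarith
      _ = al * (n * (q * S) - (2 * r : ℕ) ^ 2 * (l * K)) := by ring
      _ ≤ al * (n * T) := mul_le_mul_of_nonneg_left hlow hal0
      _ = n * (al * T) := by ring
  refine nonneg_of_mul_nonneg_right ?_ hn0
  rw [Finset.mul_sum]
  refine Finset.sum_nonneg fun I hI => ?_
  rw [Finset.mul_sum]
  refine le_trans ?_ (Finset.sum_le_sum (hpair I hI))
  rw [Finset.sum_sub_distrib, Finset.sum_ite_eq, if_pos hI, Finset.sum_const, nsmul_eq_mul]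
  have herr : 0 ≤ err * K := by positivity
  nlinarith [mul_le_mul_of_nonneg_right hPcard herr, mul_le_mul_of_nonneg_right hnum hK]

theorem exists_cliqueMoment_combination (G : SimpleGraph V) {r k : ℕ} (hr : 1 ≤ r)
    (hk : 2 * r ≤ k) (U : Finset V) (hU : #U ≤ r) :
    ∃ z : Finset V → ℝ, ∀ W, #W ≤ r → cliqueMoment G r k (U ∪ W)
      = ∑ I ∈ Finset.univ.powersetCard r, z I * cliqueMoment G r k (I ∪ W) := by
  obtain ⟨m, hm⟩ : ∃ m, m = r - #U := ⟨_, rfl⟩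
  induction m generalizing U with
  | zero =>
    have hU' : U ∈ (Finset.univ : Finset V).powersetCard r := by
      rw [Finset.mem_powersetCard_univ]; omega
    refine ⟨fun I => if I = U then 1 else 0, fun W _ => ?_⟩
    simp only [ite_mul, one_mul, zero_mul]
    rw [Finset.sum_ite_eq', if_pos hU']
  | succ m ih =>
    have hins : ∀ i : (Uᶜ : Finset V), #(insert i.1 U) = #U + 1 := fun i =>
      Finset.card_insert_of_notMem (Finset.mem_compl.1 i.2)
    choose z hz using fun i : (Uᶜ : Finset V) => ih (insert i.1 U) (by rw [hins]; omega)
      (by rw [hins]; omega)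
    have hkU : (0 : ℝ) < k - #U := by
      have : (#U : ℝ) < k := by exact_mod_cast (by omega : #U < k)
      linarith
    refine ⟨fun I => (k - #U : ℝ)⁻¹ * ∑ i, z i I, fun W hW => ?_⟩
    have hcard : #(U ∪ W) < 2 * r := by
      have := Finset.card_union_le U W
      omega
    have h1 := cliqueMoment_marginal G hk hcard
    rw [← Finset.sum_add_sum_compl U] at h1
    have h2 : ∑ i ∈ U, cliqueMoment G r k (insert i (U ∪ W))
        = #U * cliqueMoment G r k (U ∪ W) := by
      rw [Finset.sum_congr rfl fun i hi => by
        rw [Finset.insert_eq_of_mem (Finset.mem_union_left _ hi)]]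
      simp
    have h3 : ∑ i ∈ Uᶜ, cliqueMoment G r k (insert i (U ∪ W))
        = ∑ I ∈ Finset.univ.powersetCard r, (∑ i, z i I) * cliqueMoment G r k (I ∪ W) := by
      rw [← Finset.sum_coe_sort]
      simp_rw [Finset.sum_mul]
      rw [Finset.sum_comm]
      refine Finset.sum_congr rfl fun i _ => ?_
      rw [← hz i W hW, Finset.insert_union]
    rw [h2, h3] at h1
    simp_rw [mul_assoc]
    rw [← Finset.mul_sum, eq_inv_mul_iff_mul_eq₀ hkU.ne']
    linarith

/-- The linear functional on polynomials given by the clique moments. -/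
noncomputable def cliqueFunctional (G : SimpleGraph V) (r k : ℕ) : MvPolynomial V ℝ →ₗ[ℝ] ℝ :=
  (MvPolynomial.basisMonomials V ℝ).constr ℝ fun m => cliqueMoment G r k m.support

theorem cliqueFunctional_monomial (G : SimpleGraph V) (r k : ℕ) (m : V →₀ ℕ) (a : ℝ) :
    cliqueFunctional G r k (MvPolynomial.monomial m a) = a * cliqueMoment G r k m.support := by
  have h : MvPolynomial.monomial m a = a • MvPolynomial.basisMonomials V ℝ m := by
    simp [MvPolynomial.smul_monomial]
  rw [h, map_smul, cliqueFunctional, Module.Basis.constr_basis, smul_eq_mul]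

omit [Fintype V] [DecidableEq V] in
theorem map_mul_eq_zero_of_monomial (L : MvPolynomial V ℝ →ₗ[ℝ] ℝ) (f g : MvPolynomial V ℝ)
    (h : ∀ m ∈ g.support, L (f * MvPolynomial.monomial m 1) = 0) : L (f * g) = 0 := by
  conv_lhs => rw [g.as_sum, Finset.mul_sum, map_sum]
  refine Finset.sum_eq_zero fun m hm => ?_
  have : MvPolynomial.monomial m (g.coeff m) = g.coeff m • MvPolynomial.monomial m (1 : ℝ) := by
    simp [MvPolynomial.smul_monomial]
  rw [this, mul_smul_comm, map_smul, h m hm, smul_zero]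

theorem cliqueFunctional_X_mul_monomial (G : SimpleGraph V) (r k : ℕ) (i : V) (m : V →₀ ℕ) :
    cliqueFunctional G r k (MvPolynomial.X i * MvPolynomial.monomial m 1)
      = cliqueMoment G r k (insert i m.support) := by
  rw [MvPolynomial.X, MvPolynomial.monomial_mul, cliqueFunctional_monomial, mul_one, one_mul,
    Finsupp.support_add_eq_union, Finsupp.support_single _ one_ne_zero]
  rfl

theorem cliqueFunctional_boolean (G : SimpleGraph V) (r k : ℕ) (i : V) (g : MvPolynomial V ℝ) :
    cliqueFunctional G r k ((MvPolynomial.X i ^ 2 - MvPolynomial.X i) * g) = 0 := by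
  refine map_mul_eq_zero_of_monomial _ _ _ fun m _ => ?_
  rw [sub_mul, map_sub, cliqueFunctional_X_mul_monomial, pow_two, mul_assoc]
  nth_rewrite 2 [MvPolynomial.X]
  rw [MvPolynomial.monomial_mul, one_mul, cliqueFunctional_X_mul_monomial,
    Finsupp.support_add_eq_union, Finsupp.support_single _ one_ne_zero]
  simp

theorem cliqueFunctional_nonedge (G : SimpleGraph V) (r k : ℕ) {i j : V} (hij : i ≠ j)
    (h : ¬ G.Adj i j) (g : MvPolynomial V ℝ) :
    cliqueFunctional G r k ((MvPolynomial.X i * MvPolynomial.X j) * g) = 0 := by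
  refine map_mul_eq_zero_of_monomial _ _ _ fun m _ => ?_
  rw [mul_assoc]
  nth_rewrite 2 [MvPolynomial.X]
  rw [MvPolynomial.monomial_mul, one_mul, cliqueFunctional_X_mul_monomial,
    Finsupp.support_add_eq_union, Finsupp.support_single _ one_ne_zero]
  exact cliqueMoment_eq_zero G r k (by simp) (by simp) hij h

omit [Fintype V] [DecidableEq V] in
theorem card_support_le_sum (m : V →₀ ℕ) : #m.support ≤ m.sum fun _ e => e := by
  rw [Finset.card_eq_sum_ones]
  exact Finset.sum_le_sum fun i hi => Nat.one_le_iff_ne_zero.2 (Finsupp.mem_support_iff.1 hi)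

theorem cliqueFunctional_size [Nonempty V] (G : SimpleGraph V) {r k : ℕ} (hk : 2 * r ≤ k)
    (g : MvPolynomial V ℝ)
    (hg : ((∑ i, MvPolynomial.X i - MvPolynomial.C (k : ℝ)) * g).totalDegree ≤ 2 * r) :
    cliqueFunctional G r k ((∑ i, MvPolynomial.X i - MvPolynomial.C (k : ℝ)) * g) = 0 := by
  rcases eq_or_ne g 0 with rfl | hg0
  · simp
  obtain ⟨i₀⟩ := ‹Nonempty V›
  have hcoeff : (∑ i, MvPolynomial.X i - MvPolynomial.C (k : ℝ) : MvPolynomial V ℝ).coeff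
      (Finsupp.single i₀ 1) = 1 := by
    rw [MvPolynomial.coeff_sub, MvPolynomial.coeff_sum, MvPolynomial.coeff_C]
    have h0 : (0 : V →₀ ℕ) ≠ Finsupp.single i₀ 1 := (Finsupp.single_ne_zero.2 one_ne_zero).symm
    simp [MvPolynomial.coeff_X, Finsupp.single_left_inj, h0]
  have hf0 : (∑ i, MvPolynomial.X i - MvPolynomial.C (k : ℝ) : MvPolynomial V ℝ) ≠ 0 := by
    intro h
    rw [h] at hcoeff
    simp at hcoeff
  have hf1 : 1 ≤ (∑ i, MvPolynomial.X i - MvPolynomial.C (k : ℝ) : MvPolynomial V ℝ).totalDegree := by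
    have h := MvPolynomial.le_totalDegree (s := Finsupp.single i₀ 1)
      (p := (∑ i, MvPolynomial.X i - MvPolynomial.C (k : ℝ) : MvPolynomial V ℝ))
      (by rw [MvPolynomial.mem_support_iff, hcoeff]; exact one_ne_zero)
    simpa using h
  rw [MvPolynomial.totalDegree_mul_of_isDomain hf0 hg0] at hg
  refine map_mul_eq_zero_of_monomial _ _ _ fun m hm => ?_
  have hm1 : #m.support < 2 * r := by
    have h1 := MvPolynomial.le_totalDegree hm
    have h2 := card_support_le_sum m
    omega
  rw [sub_mul, map_sub, Finset.sum_mul, map_sum]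
  simp_rw [cliqueFunctional_X_mul_monomial]
  rw [cliqueMoment_marginal G hk hm1, MvPolynomial.C_mul_monomial, cliqueFunctional_monomial,
    mul_one, sub_self]

theorem cliqueFunctional_sq_nonneg (G : SimpleGraph V) {r k : ℕ} (hr : 1 ≤ r) (hk : 2 * r ≤ k)
    (hpos : ∀ Z : Finset V → ℝ,
      0 ≤ ∑ I ∈ Finset.univ.powersetCard r, ∑ J ∈ Finset.univ.powersetCard r,
        Z I * Z J * cliqueMoment G r k (I ∪ J))
    (h : MvPolynomial V ℝ) (hdeg : h.totalDegree ≤ r) :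
    0 ≤ cliqueFunctional G r k (h ^ 2) := by
  have hcard : ∀ m ∈ h.support, #m.support ≤ r := fun m hm => by
    have h1 := MvPolynomial.le_totalDegree hm
    have h2 := card_support_le_sum m
    omega
  choose! z hz using fun (m : V →₀ ℕ) (hm : m ∈ h.support) =>
    exists_cliqueMoment_combination G hr hk m.support (hcard m hm)
  have key : cliqueFunctional G r k (h ^ 2)
      = ∑ m ∈ h.support, ∑ m' ∈ h.support,
        h.coeff m * h.coeff m' * cliqueMoment G r k (m.support ∪ m'.support) := by
    conv_lhs => rw [pow_two, h.as_sum, Finset.sum_mul_sum, map_sum]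
    refine Finset.sum_congr rfl fun m _ => ?_
    rw [map_sum]
    refine Finset.sum_congr rfl fun m' _ => ?_
    rw [MvPolynomial.monomial_mul, cliqueFunctional_monomial, Finsupp.support_add_eq_union]
  have hterm : ∀ m ∈ h.support, ∀ m' ∈ h.support,
      cliqueMoment G r k (m.support ∪ m'.support)
      = ∑ I ∈ Finset.univ.powersetCard r, ∑ J ∈ Finset.univ.powersetCard r,
        z m I * z m' J * cliqueMoment G r k (I ∪ J) := by
    intro m hm m' hm'
    rw [hz m hm _ (hcard m' hm')]
    refine Finset.sum_congr rfl fun I hI => ?_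
    rw [Finset.union_comm, hz m' hm' I (Finset.mem_powersetCard_univ.1 hI).le, Finset.mul_sum]
    exact Finset.sum_congr rfl fun J _ => by rw [Finset.union_comm]; ring
  have hfin := hpos fun I => ∑ m ∈ h.support, h.coeff m * z m I
  rw [key, Finset.sum_congr rfl fun m hm => Finset.sum_congr rfl fun m' hm' => by
    rw [hterm m hm m' hm']]
  refine hfin.trans_eq ?_
  simp_rw [Finset.sum_mul_sum, Finset.sum_mul, Finset.mul_sum]
  calc _ = ∑ I ∈ Finset.univ.powersetCard r, ∑ m ∈ h.support, ∑ J ∈ Finset.univ.powersetCard r,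
        ∑ m' ∈ h.support, h.coeff m * z m I * (h.coeff m' * z m' J)
          * cliqueMoment G r k (I ∪ J) :=
        Finset.sum_congr rfl fun I _ => Finset.sum_comm
    _ = ∑ m ∈ h.support, ∑ I ∈ Finset.univ.powersetCard r, ∑ m' ∈ h.support,
        ∑ J ∈ Finset.univ.powersetCard r, h.coeff m * z m I * (h.coeff m' * z m' J)
          * cliqueMoment G r k (I ∪ J) := by
        rw [Finset.sum_comm]
        exact Finset.sum_congr rfl fun m _ => Finset.sum_congr rfl fun I _ => Finset.sum_comm
    _ = _ := by
        refine Finset.sum_congr rfl fun m _ => ?_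
        rw [Finset.sum_comm]
        refine Finset.sum_congr rfl fun m' _ => Finset.sum_congr rfl fun I _ =>
          Finset.sum_congr rfl fun J _ => ?_
        ring

end Positivity

section Refutation

theorem exists_isCliqueTuple {V : Type*} {m : ℕ} (G : SimpleGraph V)
    (h : ∀ S : Finset V, #S < m → ∃ v, ∀ u ∈ S, G.Adj u v) :
    ∃ φ : Fin m → V, IsCliqueTuple G φ := by
  classical
  induction m with
  | zero => exact ⟨Fin.elim0, fun a => a.elim0⟩
  | succ m ih =>
    obtain ⟨φ, hφ⟩ := ih fun S hS => h S (hS.trans (Nat.lt_succ_self m))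
    obtain ⟨v, hv⟩ := h (Finset.univ.image φ)
      (Nat.lt_succ_of_le (Finset.card_image_le.trans_eq (by simp)))
    have hv' : ∀ a, G.Adj (φ a) v := fun a => hv _ (Finset.mem_image_of_mem _ (Finset.mem_univ a))
    refine ⟨Fin.snoc φ v, fun a b => ?_⟩
    refine Fin.lastCases ?_ (fun a => ?_) a <;> refine Fin.lastCases ?_ (fun b => ?_) b
    · simp
    · intro _
      simpa using (hv' b).symm
    · intro _
      simpa using hv' a
    · intro hab
      simpa using hφ a b fun h => hab (h ▸ rfl)

/-- A graph with a clique of size `k` satisfies `Clique(G,k)`, so there is no refutation. -/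
theorem not_hasPSRefutationClique_of_isNClique {n r k : ℕ} {G : SimpleGraph (Fin n)}
    {S : Finset (Fin n)} (hS : G.IsNClique k S) : ¬ HasPSRefutationClique n r k G := by
  classical
  rintro ⟨g₁, g₂, g₃, N, h, -, -, -, -, hid⟩
  have he := congrArg (MvPolynomial.eval fun i => if i ∈ S then (1 : ℝ) else 0) hid
  simp only [map_add, map_sum, map_mul, map_sub, map_pow, map_one, MvPolynomial.eval_X,
    MvPolynomial.eval_C] at he
  have e1 : ∀ i : Fin n, ((if i ∈ S then (1 : ℝ) else 0) ^ 2 - if i ∈ S then (1 : ℝ) else 0) = 0 :=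
    fun i => by split_ifs <;> norm_num
  have e2 : ∑ i : Fin n, (if i ∈ S then (1 : ℝ) else 0) - (k : ℝ) = 0 := by
    simp [hS.2]
  have e3 : ∀ i j, MvPolynomial.eval (fun i => if i ∈ S then (1 : ℝ) else 0)
      (if i ≠ j ∧ ¬ G.Adj i j then (MvPolynomial.X i * MvPolynomial.X j) * g₂ i j else 0) = 0 := by
    intro i j
    split_ifs with hij
    · rw [map_mul, map_mul, MvPolynomial.eval_X, MvPolynomial.eval_X]
      by_cases hi : i ∈ S
      · have hj : j ∉ S := fun hj => hij.2 (hS.1 (by simpa using hi) (by simpa using hj) hij.1)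
        simp [hj]
      · simp [hi]
    · simp
  simp only [e1, e2, e3, zero_mul, Finset.sum_const_zero, add_zero] at he
  have : 0 ≤ ∑ j, (MvPolynomial.eval (fun i => if i ∈ S then (1 : ℝ) else 0)) (h j) ^ 2 :=
    Finset.sum_nonneg fun _ _ => sq_nonneg _
  linarith

theorem not_hasPSRefutationClique {n r k : ℕ} (hn : 1 ≤ n) (hr : 1 ≤ r) (hk : 1 ≤ k)
    {G : SimpleGraph (Fin n)} {l c : ℝ} (hl : 0 ≤ l) (hc : 0 < c) (hG : CenteredNormLE G l)
    (hN : ∀ U : Finset (Fin n), #U ≤ 2 * r → c * n ≤ ∑ v, ∏ u ∈ U, adjInd G u v)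
    (hnum : 2 * r ≤ k → 4 ^ r * ((k : ℝ) ^ (2 * r) * ((2 * r : ℕ) ^ 2 * l))
      ≤ (n : ℝ) * ((k.choose r : ℝ) / ((2 * r).choose r : ℝ)
        * ((1 / 2) ^ ((2 * r) ^ 2) * c ^ r))) :
    ¬ HasPSRefutationClique n r k G := by
  classical
  have : Nonempty (Fin n) := ⟨⟨0, hn⟩⟩
  obtain ⟨φ, hφ⟩ : ∃ φ : Fin (2 * r) → Fin n, IsCliqueTuple G φ := by
    refine exists_isCliqueTuple G fun S hS => ?_
    by_contra! hv
    have h1 : ∑ v, ∏ u ∈ S, adjInd G u v = 0 := Finset.sum_eq_zero fun v _ => by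
      obtain ⟨u, hu, huv⟩ := hv v
      exact Finset.prod_eq_zero hu (by simp [adjInd, huv])
    have h2 := hN S hS.le
    have h3 : (0 : ℝ) < c * n := mul_pos hc (by exact_mod_cast hn)
    linarith
  rcases lt_or_ge k (2 * r) with hkr | hkr
  · refine not_hasPSRefutationClique_of_isNClique (S := Finset.univ.image fun i : Fin k =>
      φ (Fin.castLE hkr.le i)) ⟨?_, ?_⟩
    · intro u hu v hv huv
      obtain ⟨a, -, rfl⟩ := Finset.mem_image.1 (Finset.mem_coe.1 hu)
      obtain ⟨b, -, rfl⟩ := Finset.mem_image.1 (Finset.mem_coe.1 hv)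
      exact hφ _ _ fun h => huv (h ▸ rfl)
    · rw [Finset.card_image_of_injective _ fun a b hab =>
        Fin.castLE_injective hkr.le (hφ.injective hab), Finset.card_univ, Fintype.card_fin]
  rintro ⟨g₁, g₂, g₃, N, h, -, -, hd₃, hd, hid⟩
  have hpos := sum_cliqueMoment_union_nonneg (r := r) hk hl hc.le hG
    (fun U hU => by
      rw [Fintype.card_fin]
      exact hN U (by rw [hU.2]; omega))
    (by rw [Fintype.card_fin]; exact hnum hkr)
  have he := congrArg (cliqueFunctional G r k) hid
  have e2 : ∀ i j, cliqueFunctional G r k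
      (if i ≠ j ∧ ¬ G.Adj i j then (MvPolynomial.X i * MvPolynomial.X j) * g₂ i j else 0) = 0 := by
    intro i j
    split_ifs with hij
    · exact cliqueFunctional_nonedge G r k hij.1 hij.2 _
    · simp
  have e1 : cliqueFunctional G r k 1 = cliqueMoment G r k ∅ := by
    have := cliqueFunctional_monomial G r k 0 1
    simpa using this
  simp only [map_add, map_sum, cliqueFunctional_boolean, e2, cliqueFunctional_size G hkr g₃ hd₃,
    Finset.sum_const_zero, add_zero, e1] at he
  have h1 : 0 ≤ ∑ j, cliqueFunctional G r k (h j ^ 2) := Finset.sum_nonneg fun j _ =>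
    cliqueFunctional_sq_nonneg G hr hkr hpos (h j) (hd j)
  have h2 := cliqueMoment_empty_pos (k := k) hφ
  linarith

end Refutation

section Independence

variable {ι V κ : Type*} [Fintype ι] [DecidableEq ι] [Fintype V]

/-- Under the uniform measure, functions of disjoint sets of coordinates are independent. -/
theorem sum_prod_eq_of_pairwiseDisjoint [Nonempty V] (T : Finset κ) (A : κ → Finset ι)
    (hA : (T : Set κ).PairwiseDisjoint A) (F : κ → (ι → V) → ℝ)
    (hF : ∀ j ∈ T, ∀ φ ψ, (∀ i ∈ A j, φ i = ψ i) → F j φ = F j ψ) (μ : κ → ℝ)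
    (hμ : ∀ j ∈ T, ∑ φ, F j φ = (Fintype.card V : ℝ) ^ Fintype.card ι * μ j) :
    ∑ φ, ∏ j ∈ T, F j φ = (Fintype.card V : ℝ) ^ Fintype.card ι * ∏ j ∈ T, μ j := by
  classical
  induction T using Finset.induction_on with
  | empty => simp
  | insert j T hj ih =>
    have hN : (0 : ℝ) < (Fintype.card V : ℝ) ^ Fintype.card ι := by
      have : 0 < Fintype.card V := Fintype.card_pos
      positivity
    have ih' := ih (hA.subset (by simp)) (fun i hi => hF i (Finset.mem_insert_of_mem hi))
      (fun i hi => hμ i (Finset.mem_insert_of_mem hi))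
    have h := card_pow_mul_sum_mul (A j) (F j) (fun φ => ∏ i ∈ T, F i φ)
      (hF j (Finset.mem_insert_self _ _)) (fun φ ψ h => Finset.prod_congr rfl fun i hi =>
        hF i (Finset.mem_insert_of_mem hi) φ ψ fun e he => h e fun he' => by
          have hd := hA (by simp [hi] : i ∈ ((insert j T : Finset κ) : Set κ))
            (by simp : j ∈ ((insert j T : Finset κ) : Set κ)) (fun hij => hj (hij ▸ hi))
          exact Finset.disjoint_left.1 hd he he')
    rw [hμ j (Finset.mem_insert_self _ _), ih'] at h
    simp_rw [Finset.prod_insert hj]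
    refine mul_left_cancel₀ hN.ne' (h.trans ?_)
    ring

end Independence

section RandomGraph

variable {V : Type*} [Fintype V] [DecidableEq V]

omit [Fintype V] [DecidableEq V] in
/-- The graph whose edges are the pairs marked `true`. -/
def graphOfPairs (ω : {e : Sym2 V // ¬ e.IsDiag} → Bool) : SimpleGraph V where
  Adj u v := ∃ h : ¬ s(u, v).IsDiag, ω ⟨s(u, v), h⟩ = true
  symm := ⟨fun u v => by rw [Sym2.eq_swap]; exact id⟩
  loopless := ⟨fun u h => h.1 (by simp)⟩

omit [Fintype V] [DecidableEq V] in
theorem graphOfPairs_bijective : Function.Bijective (graphOfPairs (V := V)) := by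
  classical
  constructor
  · intro ω ω' h
    funext ⟨e, he⟩
    induction e with
    | _ u v =>
      have h1 : (graphOfPairs ω).Adj u v ↔ (graphOfPairs ω').Adj u v := by rw [h]
      simp only [graphOfPairs, he, not_false_eq_true, exists_true_left] at h1
      exact Bool.eq_iff_iff.2 h1
  · intro G
    refine ⟨fun e => decide (e.1 ∈ G.edgeSet), ?_⟩
    ext u v
    simp only [graphOfPairs, Sym2.mk_isDiag_iff, SimpleGraph.mem_edgeSet, decide_eq_true_eq,
      exists_prop]
    exact ⟨fun h => h.2, fun h => ⟨h.ne, h⟩⟩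

/-- The sign `±1` of a Boolean. -/
noncomputable def boolSign (b : Bool) : ℝ := if b then 1 else -1

omit [Fintype V] [DecidableEq V] in
theorem adjInd_graphOfPairs_of_eq (ω : {e : Sym2 V // ¬ e.IsDiag} → Bool) {u v : V} (h : u = v) :
    adjInd (graphOfPairs ω) u v = 0 := by
  subst h
  simp [adjInd]

omit [Fintype V] [DecidableEq V] in
theorem adjInd_graphOfPairs_of_ne (ω : {e : Sym2 V // ¬ e.IsDiag} → Bool) {u v : V} (h : u ≠ v) :
    adjInd (graphOfPairs ω) u v = if ω ⟨s(u, v), by simpa using h⟩ then 1 else 0 := by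
  simp [adjInd, graphOfPairs, h]

theorem sum_exp_boolSign_le {ι : Type*} [Fintype ι] [DecidableEq ι] (c : ι → ℝ) :
    ∑ ω : ι → Bool, Real.exp (∑ e, boolSign (ω e) * c e)
      ≤ 2 ^ Fintype.card ι * Real.exp ((∑ e, c e ^ 2) / 2) := by
  have h1 : ∀ e : ι, ∑ b : Bool, Real.exp (boolSign b * c e) = 2 * Real.cosh (c e) := fun e => by
    rw [Fintype.sum_bool, Real.cosh_eq]
    simp only [boolSign, if_true, Bool.false_eq_true, if_false, one_mul, neg_one_mul]
    ring
  calc ∑ ω : ι → Bool, Real.exp (∑ e, boolSign (ω e) * c e)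
      = ∏ e : ι, ∑ b : Bool, Real.exp (boolSign b * c e) := by
        rw [Finset.prod_univ_sum, Fintype.piFinset_univ]
        exact Finset.sum_congr rfl fun ω _ => Real.exp_sum _ _
    _ ≤ ∏ e : ι, (2 * Real.exp (c e ^ 2 / 2)) := by
        refine Finset.prod_le_prod (fun e _ => Finset.sum_nonneg fun _ _ => (Real.exp_pos _).le)
          fun e _ => ?_
        rw [h1]
        exact mul_le_mul_of_nonneg_left (Real.cosh_le_exp_half_sq _) zero_le_two
    _ = _ := by
        rw [Finset.prod_mul_distrib, ← Real.exp_sum, Finset.sum_div]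
        simp

/-- A Chernoff bound for signed sums. -/
theorem card_lt_sum_boolSign_le {ι : Type*} [Fintype ι] [DecidableEq ι] (c : ι → ℝ) {s t : ℝ}
    (hs : 0 < s) (ht : 0 ≤ t) (hc : ∑ e, c e ^ 2 ≤ s) :
    (#{ω : ι → Bool | t < ∑ e, boolSign (ω e) * c e} : ℝ)
      ≤ 2 ^ Fintype.card ι * Real.exp (-(t ^ 2 / (2 * s))) := by
  have h1 := sum_exp_boolSign_le fun e => t / s * c e
  have h2 : (#{ω : ι → Bool | t < ∑ e, boolSign (ω e) * c e} : ℝ) * Real.exp (t ^ 2 / s)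
      ≤ ∑ ω : ι → Bool, Real.exp (∑ e, boolSign (ω e) * (t / s * c e)) := by
    rw [← nsmul_eq_mul, ← Finset.sum_const]
    refine (Finset.sum_le_sum fun ω hω => ?_).trans (Finset.sum_le_sum_of_subset_of_nonneg
      (Finset.subset_univ _) fun _ _ _ => (Real.exp_pos _).le)
    have hω' := (Finset.mem_filter.1 hω).2
    rw [Real.exp_le_exp]
    calc t ^ 2 / s = t / s * t := by ring
      _ ≤ t / s * ∑ e, boolSign (ω e) * c e := by gcongr
      _ = _ := by
        rw [Finset.mul_sum]
        exact Finset.sum_congr rfl fun e _ => by ring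
  have h3 : (∑ e, (t / s * c e) ^ 2) / 2 ≤ t ^ 2 / (2 * s) := by
    calc (∑ e, (t / s * c e) ^ 2) / 2 = (t / s) ^ 2 * (∑ e, c e ^ 2) / 2 := by
          rw [Finset.mul_sum]
          simp_rw [mul_pow]
      _ ≤ (t / s) ^ 2 * s / 2 := by gcongr
      _ = t ^ 2 / (2 * s) := by field_simp
  have h4 : Real.exp (-(t ^ 2 / (2 * s))) * Real.exp (t ^ 2 / s) = Real.exp (t ^ 2 / (2 * s)) := by
    rw [← Real.exp_add]
    congr 1
    field_simp
    ring
  refine le_of_mul_le_mul_right ?_ (Real.exp_pos (t ^ 2 / s))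
  rw [mul_assoc, h4]
  refine h2.trans (h1.trans ?_)
  gcongr

/-- The coefficient of the pair `e` in the bilinear form of the centred adjacency matrix. -/
noncomputable def pairCoeff (p q : V → ℝ) (e : Sym2 V) : ℝ :=
  ∑ x : V × V with s(x.1, x.2) = e, p x.1 * q x.2

theorem sum_pairCoeff_sq_le (p q : V → ℝ) :
    ∑ e : {e : Sym2 V // ¬ e.IsDiag}, pairCoeff p q e.1 ^ 2
      ≤ 2 * ((∑ u, p u ^ 2) * ∑ v, q v ^ 2) := by
  have h1 : ∀ e : Sym2 V, pairCoeff p q e ^ 2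
      ≤ 2 * ∑ x : V × V with s(x.1, x.2) = e, (p x.1 * q x.2) ^ 2 := fun e => by
    refine sq_sum_le_card_mul_sum_sq.trans ?_
    refine mul_le_mul_of_nonneg_right ?_ (Finset.sum_nonneg fun _ _ => sq_nonneg _)
    induction e with
    | _ a b =>
      have : (Finset.univ.filter fun x : V × V => s(x.1, x.2) = s(a, b)) ⊆ {(a, b), (b, a)} := by
        rintro ⟨x, y⟩ h
        simpa using h
      exact_mod_cast (Finset.card_le_card this).trans Finset.card_le_two
  calc ∑ e : {e : Sym2 V // ¬ e.IsDiag}, pairCoeff p q e.1 ^ 2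
      ≤ ∑ e : Sym2 V, pairCoeff p q e ^ 2 := by
        refine (Finset.sum_map Finset.univ (Function.Embedding.subtype _)
          fun e => pairCoeff p q e ^ 2).symm.trans_le ?_
        exact Finset.sum_le_sum_of_subset_of_nonneg (Finset.subset_univ _) fun _ _ _ => sq_nonneg _
    _ ≤ ∑ e : Sym2 V, 2 * ∑ x : V × V with s(x.1, x.2) = e, (p x.1 * q x.2) ^ 2 :=
        Finset.sum_le_sum fun e _ => h1 e
    _ = 2 * ((∑ u, p u ^ 2) * ∑ v, q v ^ 2) := by
        rw [← Finset.mul_sum, Finset.sum_fiberwise, Fintype.sum_prod_type, Finset.sum_mul_sum]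
        simp_rw [mul_pow]

theorem sum_boolSign_pairCoeff (ω : {e : Sym2 V // ¬ e.IsDiag} → Bool) (p q : V → ℝ) :
    ∑ e, boolSign (ω e) * pairCoeff p q e.1
      = ∑ u, ∑ v, (2 * adjInd (graphOfPairs ω) u v - if u = v then 0 else 1) * p u * q v := by
  simp_rw [pairCoeff, Finset.mul_sum, Finset.sum_filter]
  rw [Finset.sum_comm, Fintype.sum_prod_type]
  refine Finset.sum_congr rfl fun u _ => Finset.sum_congr rfl fun v _ => ?_
  by_cases h : u = v
  · rw [adjInd_graphOfPairs_of_eq ω h, if_pos h]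
    refine (Finset.sum_eq_zero fun e _ => if_neg fun he => e.2 ?_).trans (by ring)
    rw [← he, h]
    simp
  · have hd : ¬ s(u, v).IsDiag := by simpa using h
    rw [adjInd_graphOfPairs_of_ne ω h, if_neg h, Finset.sum_eq_single ⟨s(u, v), hd⟩]
    · simp only [if_true, boolSign]
      split_ifs <;> ring
    · exact fun e _ he => if_neg fun he' => he (Subtype.ext he'.symm)
    · simp

end RandomGraph

section Net

/-- A net of the unit ball, fine enough to control the norm of every linear form. -/
theorem exists_finset_sum_mul_le (ι : Type*) [Fintype ι] :
    ∃ s : Finset (ι → ℝ), #s ≤ 5 ^ Fintype.card ι ∧ (∀ c ∈ s, ∑ i, c i ^ 2 ≤ 4) ∧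
      ∀ (a : ι → ℝ) (t : ℝ), (∀ c ∈ s, |∑ i, a i * c i| ≤ t) →
        ∀ x : ι → ℝ, |∑ i, a i * x i| ≤ t * √(∑ i, x i ^ 2) := by
  classical
  let E := EuclideanSpace ℝ ι
  let P : Finset E → Prop := fun s =>
    (∀ c ∈ s, ‖c‖ ≤ 2) ∧ ∀ c ∈ s, ∀ d ∈ s, c ≠ d → 1 ≤ ‖c - d‖
  have hP : ∀ s, P s → #s ≤ 5 ^ Fintype.card ι := fun s hs => by
    have := Besicovitch.card_le_of_separated s hs.1 hs.2
    rwa [finrank_euclideanSpace] at this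
  obtain ⟨s, hs, hmax⟩ : ∃ s, P s ∧ ∀ s', P s' → #s' ≤ #s := by
    have hbdd : BddAbove {m | ∃ s, P s ∧ #s = m} :=
      ⟨5 ^ Fintype.card ι, by rintro m ⟨s, hs, rfl⟩; exact hP s hs⟩
    have hne : {m | ∃ s, P s ∧ #s = m}.Nonempty := ⟨_, ∅, by simp [P], rfl⟩
    obtain ⟨s, hs, hcard⟩ := Nat.sSup_mem hne hbdd
    exact ⟨s, hs, fun s' hs' => hcard ▸ le_csSup hbdd ⟨s', hs', rfl⟩⟩
  have hnet : ∀ y : E, ‖y‖ ≤ 2 → ∃ c ∈ s, ‖y - c‖ ≤ 1 := by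
    intro y hy
    by_contra! hfar
    have hys : y ∉ s := fun h => by
      have := hfar y h
      rw [sub_self, norm_zero] at this
      linarith
    have hP' : P (insert y s) := by
      refine ⟨fun c hc => ?_, fun c hc d hd hcd => ?_⟩
      · rcases Finset.mem_insert.1 hc with rfl | hc
        exacts [hy, hs.1 c hc]
      · rcases Finset.mem_insert.1 hc with rfl | hc' <;>
          rcases Finset.mem_insert.1 hd with rfl | hd'
        · exact absurd rfl hcd
        · exact (hfar d hd').le
        · rw [norm_sub_rev]
          exact (hfar c hc').le
        · exact hs.2 c hc' d hd' hcd
    have := hmax _ hP'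
    rw [Finset.card_insert_of_notMem hys] at this
    omega
  have hnorm : ∀ x : E, ‖x‖ = √(∑ i, x i ^ 2) := fun x =>
    (EuclideanSpace.norm_eq x).trans (by simp)
  refine ⟨s.image fun c => c.ofLp, Finset.card_image_le.trans (hP s hs), ?_, ?_⟩
  · intro c hc
    obtain ⟨d, hd, rfl⟩ := Finset.mem_image.1 hc
    have h1 := hs.1 d hd
    rw [hnorm, Real.sqrt_le_left zero_le_two] at h1
    linarith
  · intro a t ht x
    let F : E →L[ℝ] ℝ := ∑ i, a i • EuclideanSpace.proj i
    have hF : ∀ y : E, F y = ∑ i, a i * y i := fun y => by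
      simp only [F, _root_.sum_apply, _root_.smul_apply, smul_eq_mul]
      rfl
    have ht' : ∀ c ∈ s, |F c| ≤ t := fun c hc => by
      rw [hF]
      exact ht _ (Finset.mem_image_of_mem _ hc)
    have hball : ∀ y : E, ‖y‖ ≤ 2 → |F y| ≤ t + ‖F‖ := fun y hy => by
      obtain ⟨c, hc, hyc⟩ := hnet y hy
      have h1 : F y = F c + F (y - c) := by rw [map_sub]; ring
      have h2 : |F (y - c)| ≤ ‖F‖ := (F.le_opNorm _).trans
        (mul_le_of_le_one_right (norm_nonneg _) hyc)
      rw [h1]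
      exact (abs_add_le _ _).trans (add_le_add (ht' c hc) h2)
    have h0 : 0 ≤ t + ‖F‖ := (abs_nonneg _).trans (hball 0 (by simp))
    have hFt : ‖F‖ ≤ (t + ‖F‖) / 2 := by
      refine F.opNorm_le_bound (by linarith) fun y => ?_
      rcases eq_or_ne y 0 with rfl | hy
      · simp
      have hy0 : 0 < ‖y‖ := norm_pos_iff.2 hy
      have h1 := hball ((2 / ‖y‖) • y) (by
        rw [norm_smul, Real.norm_of_nonneg (by positivity), div_mul_cancel₀ _ hy0.ne'])
      rw [map_smul, smul_eq_mul, abs_mul, abs_of_pos (by positivity : 0 < 2 / ‖y‖),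
        div_mul_eq_mul_div, div_le_iff₀ hy0] at h1
      rw [Real.norm_eq_abs]
      linarith
    have h1 := F.le_opNorm (WithLp.toLp 2 x)
    rw [hF, hnorm, Real.norm_eq_abs] at h1
    exact h1.trans (mul_le_mul_of_nonneg_right (by linarith) (Real.sqrt_nonneg _))

end Net

section SpectralNorm

variable {V : Type*} [Fintype V] [DecidableEq V]

theorem centeredNormLE_of_forall_mem {G : SimpleGraph V} {s : Finset (V → ℝ)} {t : ℝ}
    (hs : ∀ (a : V → ℝ) (t : ℝ), (∀ c ∈ s, |∑ i, a i * c i| ≤ t) →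
      ∀ x : V → ℝ, |∑ i, a i * x i| ≤ t * √(∑ i, x i ^ 2))
    (ht : ∀ c ∈ s, ∀ d ∈ s,
      |∑ u, ∑ v, (2 * adjInd G u v - if u = v then 0 else 1) * c u * d v| ≤ t) :
    CenteredNormLE G (t + 1) := by
  intro p q
  have h1 : ∀ c ∈ s, |∑ u, ∑ v, (2 * adjInd G u v - if u = v then 0 else 1) * c u * q v|
      ≤ t * √(∑ v, q v ^ 2) := fun c hc => by
    have h := hs (fun v => ∑ u, (2 * adjInd G u v - if u = v then 0 else 1) * c u) t
      (fun d hd => by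
        simp_rw [Finset.sum_mul]
        rw [Finset.sum_comm]
        exact ht c hc d hd) q
    simp_rw [Finset.sum_mul] at h
    rwa [Finset.sum_comm] at h
  have h2 : |∑ u, ∑ v, (2 * adjInd G u v - if u = v then 0 else 1) * p u * q v|
      ≤ t * √(∑ v, q v ^ 2) * √(∑ u, p u ^ 2) := by
    have hsw : ∀ c : V → ℝ, ∑ u, ∑ v, (2 * adjInd G u v - if u = v then 0 else 1) * c u * q v
        = ∑ u, (∑ v, (2 * adjInd G u v - if u = v then 0 else 1) * q v) * c u := fun c => by
      simp_rw [Finset.sum_mul]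
      exact Finset.sum_congr rfl fun u _ => Finset.sum_congr rfl fun v _ => by ring
    rw [hsw]
    exact hs _ _ (fun c hc => by rw [← hsw]; exact h1 c hc) p
  have h3 : ∑ u, ∑ v, (2 * adjInd G u v - 1) * p u * q v
      = ∑ u, ∑ v, (2 * adjInd G u v - if u = v then 0 else 1) * p u * q v - ∑ u, p u * q u := by
    rw [← Finset.sum_sub_distrib]
    refine Finset.sum_congr rfl fun u _ => ?_
    have : p u * q u = ∑ v, if u = v then p u * q v else 0 := by simp
    rw [this, ← Finset.sum_sub_distrib]
    refine Finset.sum_congr rfl fun v _ => ?_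
    split_ifs <;> ring
  have h4 : |∑ u, p u * q u| ≤ √(∑ u, p u ^ 2) * √(∑ v, q v ^ 2) := by
    rw [← Real.sqrt_mul (Finset.sum_nonneg fun _ _ => sq_nonneg _), ← Real.sqrt_sq_eq_abs]
    exact Real.sqrt_le_sqrt (Finset.sum_mul_sq_le_sq_mul_sq _ _ _)
  rw [h3]
  refine (abs_sub _ _).trans ?_
  linarith

open scoped Classical in
theorem card_not_centeredNormLE_le {t : ℝ} (ht : 0 ≤ t) :
    (#{ω : {e : Sym2 V // ¬ e.IsDiag} → Bool | ¬ CenteredNormLE (graphOfPairs ω) (t + 1)} : ℝ)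
      ≤ 2 ^ Fintype.card {e : Sym2 V // ¬ e.IsDiag}
        * (2 * 25 ^ Fintype.card V * Real.exp (-(t ^ 2 / 64))) := by
  obtain ⟨s, hcard, hball, hs⟩ := exists_finset_sum_mul_le V
  set N : ℝ := 2 ^ Fintype.card {e : Sym2 V // ¬ e.IsDiag}
  let bad : (V → ℝ) × (V → ℝ) → Finset ({e : Sym2 V // ¬ e.IsDiag} → Bool) := fun x =>
    (Finset.univ.filter fun ω => t < ∑ e, boolSign (ω e) * pairCoeff x.1 x.2 e.1)
      ∪ Finset.univ.filter fun ω => t < ∑ e, boolSign (ω e) * -pairCoeff x.1 x.2 e.1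
  have hbad : ∀ x ∈ s ×ˢ s, (#(bad x) : ℝ) ≤ 2 * (N * Real.exp (-(t ^ 2 / 64))) := fun x hx => by
    have hx' := Finset.mem_product.1 hx
    have hc : ∑ e : {e : Sym2 V // ¬ e.IsDiag}, pairCoeff x.1 x.2 e.1 ^ 2 ≤ 32 := by
      refine (sum_pairCoeff_sq_le _ _).trans ?_
      have := mul_le_mul (hball _ hx'.1) (hball _ hx'.2) (Finset.sum_nonneg fun _ _ => sq_nonneg _)
        (by norm_num)
      linarith
    have h1 := card_lt_sum_boolSign_le (fun e : {e : Sym2 V // ¬ e.IsDiag} =>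
      pairCoeff x.1 x.2 e.1) (by norm_num : (0 : ℝ) < 32) ht hc
    have h2 := card_lt_sum_boolSign_le (fun e : {e : Sym2 V // ¬ e.IsDiag} =>
      -pairCoeff x.1 x.2 e.1) (by norm_num : (0 : ℝ) < 32) ht (by simpa using hc)
    rw [show (2 : ℝ) * 32 = 64 by norm_num] at h1 h2
    refine ((Nat.cast_le (α := ℝ)).2 (Finset.card_union_le _ _)).trans ?_
    push_cast
    linarith
  have hsub : (Finset.univ.filter fun ω : {e : Sym2 V // ¬ e.IsDiag} → Bool =>
      ¬ CenteredNormLE (graphOfPairs ω) (t + 1)) ⊆ (s ×ˢ s).biUnion bad := by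
    intro ω hω
    by_contra hω'
    refine (Finset.mem_filter.1 hω).2 (centeredNormLE_of_forall_mem hs fun c hc d hd => ?_)
    have h : ω ∉ bad (c, d) := fun h =>
      hω' (Finset.mem_biUnion.2 ⟨(c, d), Finset.mk_mem_product hc hd, h⟩)
    simp only [bad, Finset.mem_union, Finset.mem_filter, Finset.mem_univ, true_and, not_or,
      not_lt, mul_neg, Finset.sum_neg_distrib] at h
    rw [sum_boolSign_pairCoeff] at h
    exact abs_le.2 ⟨by linarith [h.2], h.1⟩
  have hss : (#(s ×ˢ s) : ℝ) ≤ 25 ^ Fintype.card V := by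
    rw [Finset.card_product, show (25 : ℝ) = 5 * 5 by norm_num, mul_pow]
    exact_mod_cast Nat.mul_le_mul hcard hcard
  calc _ ≤ (#((s ×ˢ s).biUnion bad) : ℝ) := by exact_mod_cast Finset.card_le_card hsub
    _ ≤ ∑ x ∈ s ×ˢ s, (#(bad x) : ℝ) := by exact_mod_cast Finset.card_biUnion_le
    _ ≤ #(s ×ˢ s) * (2 * (N * Real.exp (-(t ^ 2 / 64)))) := by
      rw [← nsmul_eq_mul]
      exact Finset.sum_le_card_nsmul _ _ _ hbad
    _ ≤ 25 ^ Fintype.card V * (2 * (N * Real.exp (-(t ^ 2 / 64)))) := by gcongr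
    _ = _ := by ring

end SpectralNorm

section CommonNeighbors

variable {V : Type*} [Fintype V] [DecidableEq V]

/-- The pairs joining `v` to the elements of `S`. -/
def starPairs (S : Finset V) (v : V) : Finset {e : Sym2 V // ¬ e.IsDiag} :=
  Finset.univ.filter fun e => ∃ u ∈ S, e.1 = s(u, v)

theorem starPairs_pairwiseDisjoint (S : Finset V) :
    ((Sᶜ : Finset V) : Set V).PairwiseDisjoint (starPairs S) := by
  intro v hv w hw hvw
  refine Finset.disjoint_left.2 fun e he he' => ?_
  obtain ⟨u, hu, h1⟩ := (Finset.mem_filter.1 he).2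
  obtain ⟨u', hu', h2⟩ := (Finset.mem_filter.1 he').2
  rw [h1, Sym2.eq_iff] at h2
  simp only [Finset.coe_compl, Set.mem_compl_iff, Finset.mem_coe] at hv hw
  rcases h2 with ⟨-, h⟩ | ⟨h, -⟩
  · exact hvw h
  · exact hw (h ▸ hu)

theorem adjInd_graphOfPairs_congr {S : Finset V} {v : V}
    {ω ω' : {e : Sym2 V // ¬ e.IsDiag} → Bool} (h : ∀ e ∈ starPairs S v, ω e = ω' e) {u : V}
    (hu : u ∈ S) : adjInd (graphOfPairs ω) u v = adjInd (graphOfPairs ω') u v := by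
  by_cases huv : u = v
  · rw [adjInd_graphOfPairs_of_eq _ huv, adjInd_graphOfPairs_of_eq _ huv]
  · rw [adjInd_graphOfPairs_of_ne _ huv, adjInd_graphOfPairs_of_ne _ huv,
      h _ (Finset.mem_filter.2 ⟨Finset.mem_univ _, u, hu, rfl⟩)]

theorem sum_adjInd_graphOfPairs {u v : V} (h : u ≠ v) :
    ∑ ω, adjInd (graphOfPairs ω) u v
      = (Fintype.card Bool : ℝ) ^ Fintype.card {e : Sym2 V // ¬ e.IsDiag} * (1 / 2) := by
  have h1 := sum_sum_update (V := Bool) (⟨s(u, v), by simpa using h⟩ : {e : Sym2 V // ¬ e.IsDiag})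
    fun ω => adjInd (graphOfPairs ω) u v
  simp_rw [adjInd_graphOfPairs_of_ne _ h] at h1 ⊢
  simp only [Function.update_self, Fintype.sum_bool, if_true, Bool.false_eq_true, if_false,
    add_zero, Finset.sum_const, Finset.card_univ, Fintype.card_fun, nsmul_eq_mul, mul_one,
    Fintype.card_bool, Nat.cast_pow] at h1 ⊢
  push_cast at h1 ⊢
  linarith

theorem sum_prod_adjInd_graphOfPairs {S : Finset V} {v : V} (hv : v ∉ S) :
    ∑ ω, ∏ u ∈ S, adjInd (graphOfPairs ω) u v
      = (Fintype.card Bool : ℝ) ^ Fintype.card {e : Sym2 V // ¬ e.IsDiag} * (1 / 2) ^ #S := by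
  rw [sum_prod_eq_of_pairwiseDisjoint S (fun u => starPairs {u} v) ?_
    (fun u ω => adjInd (graphOfPairs ω) u v)
    (fun u _ ω ω' h => adjInd_graphOfPairs_congr h (Finset.mem_singleton_self u))
    (fun _ => 1 / 2) (fun u hu => sum_adjInd_graphOfPairs fun h => hv (h ▸ hu)), Finset.prod_const]
  intro u hu w hw huw
  refine Finset.disjoint_left.2 fun e he he' => ?_
  simp only [starPairs, Finset.mem_singleton, exists_eq_left, Finset.mem_filter, Finset.mem_univ,
    true_and] at he he'
  rw [he, Sym2.eq_iff] at he'
  rcases he' with ⟨h, -⟩ | ⟨h, -⟩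
  · exact huw h
  · exact hv (h ▸ hu)

theorem sum_prod_one_sub_graphOfPairs (S : Finset V) :
    ∑ ω, ∏ v ∈ Sᶜ, (1 - (1 / 2) * ∏ u ∈ S, adjInd (graphOfPairs ω) u v)
      = (Fintype.card Bool : ℝ) ^ Fintype.card {e : Sym2 V // ¬ e.IsDiag}
        * (1 - (1 / 2) ^ (#S + 1)) ^ #Sᶜ := by
  rw [sum_prod_eq_of_pairwiseDisjoint Sᶜ (starPairs S) (starPairs_pairwiseDisjoint S)
    (fun v ω => 1 - (1 / 2) * ∏ u ∈ S, adjInd (graphOfPairs ω) u v)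
    (fun v _ ω ω' h => by
      rw [Finset.prod_congr rfl fun u hu => adjInd_graphOfPairs_congr h hu])
    (fun _ => 1 - (1 / 2) ^ (#S + 1)) (fun v hv => ?_), Finset.prod_const]
  rw [Finset.sum_sub_distrib, ← Finset.mul_sum,
    sum_prod_adjInd_graphOfPairs (Finset.mem_compl.1 hv)]
  simp only [Finset.sum_const, Finset.card_univ, Fintype.card_fun, nsmul_eq_mul, mul_one,
    Nat.cast_pow]
  ring

omit [Fintype V] [DecidableEq V] in
theorem exp_neg_prod_adjInd_le (G : SimpleGraph V) (S : Finset V) (v : V) :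
    Real.exp (-∏ u ∈ S, adjInd G u v) ≤ 1 - (1 / 2) * ∏ u ∈ S, adjInd G u v := by
  by_cases h : ∀ u ∈ S, G.Adj u v
  · rw [Finset.prod_eq_one fun u hu => by simp [adjInd, h u hu]]
    have := Real.exp_neg_one_lt_half
    linarith
  · push Not at h
    obtain ⟨u, hu, huv⟩ := h
    rw [Finset.prod_eq_zero hu (by simp [adjInd, huv])]
    simp

/-- A fixed set `S` has few common neighbours only in an exponentially small set of graphs. -/
theorem card_commonNeighbors_lt_le (S : Finset V) (t : ℝ) :
    (#{ω : {e : Sym2 V // ¬ e.IsDiag} → Bool |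
        ∑ v, ∏ u ∈ S, adjInd (graphOfPairs ω) u v < t} : ℝ)
      ≤ 2 ^ Fintype.card {e : Sym2 V // ¬ e.IsDiag}
        * Real.exp (t - (1 / 2) ^ (#S + 1) * #Sᶜ) := by
  have h1 := sum_prod_one_sub_graphOfPairs S
  have hnn : ∀ ω : {e : Sym2 V // ¬ e.IsDiag} → Bool,
      Real.exp (-∑ v ∈ Sᶜ, ∏ u ∈ S, adjInd (graphOfPairs ω) u v)
        ≤ ∏ v ∈ Sᶜ, (1 - (1 / 2) * ∏ u ∈ S, adjInd (graphOfPairs ω) u v) := fun ω => by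
    rw [← Finset.sum_neg_distrib, Real.exp_sum]
    exact Finset.prod_le_prod (fun _ _ => (Real.exp_pos _).le)
      fun v _ => exp_neg_prod_adjInd_le _ _ _
  have h2 : (#{ω : {e : Sym2 V // ¬ e.IsDiag} → Bool |
        ∑ v, ∏ u ∈ S, adjInd (graphOfPairs ω) u v < t} : ℝ) * Real.exp (-t)
      ≤ ∑ ω, ∏ v ∈ Sᶜ, (1 - (1 / 2) * ∏ u ∈ S, adjInd (graphOfPairs ω) u v) := by
    rw [← nsmul_eq_mul, ← Finset.sum_const]
    refine (Finset.sum_le_sum fun ω hω => ?_).trans (Finset.sum_le_sum_of_subset_of_nonneg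
      (Finset.subset_univ _) fun ω _ _ => (Real.exp_pos _).le.trans (hnn ω))
    refine le_trans (Real.exp_le_exp.2 (neg_le_neg ?_)) (hnn ω)
    refine le_trans ?_ (Finset.mem_filter.1 hω).2.le
    exact Finset.sum_le_sum_of_subset_of_nonneg (Finset.subset_univ _)
      fun v _ _ => Finset.prod_nonneg fun _ _ => adjInd_nonneg _ _ _
  have h3 : (1 - (1 / 2 : ℝ) ^ (#S + 1)) ^ #Sᶜ ≤ Real.exp (-((1 / 2) ^ (#S + 1) * #Sᶜ)) := by
    have h4 : (1 / 2 : ℝ) ^ (#S + 1) ≤ 1 := pow_le_one₀ (by norm_num) (by norm_num)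
    refine (pow_le_pow_left₀ (by linarith) (Real.one_sub_le_exp_neg _) _).trans_eq ?_
    rw [← Real.exp_nat_mul]
    congr 1
    ring
  rw [h1, Fintype.card_bool] at h2
  refine le_of_mul_le_mul_right ?_ (Real.exp_pos (-t))
  rw [mul_assoc, ← Real.exp_add]
  refine h2.trans ?_
  push_cast
  refine mul_le_mul_of_nonneg_left (h3.trans_eq ?_) (by positivity)
  congr 1
  ring

/-- With high probability, all sets of `d` vertices have many common neighbours. -/
theorem card_exists_commonNeighbors_lt_le (d : ℕ) (t : ℝ) (hd : d ≤ Fintype.card V) :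
    (#{ω : {e : Sym2 V // ¬ e.IsDiag} → Bool |
        ∃ S ∈ (Finset.univ : Finset V).powersetCard d,
          ∑ v, ∏ u ∈ S, adjInd (graphOfPairs ω) u v < t} : ℝ)
      ≤ 2 ^ Fintype.card {e : Sym2 V // ¬ e.IsDiag}
        * ((Fintype.card V : ℝ) ^ d
          * Real.exp (t - (1 / 2) ^ (d + 1) * (Fintype.card V - d))) := by
  classical
  have hsub : (Finset.univ.filter fun ω : {e : Sym2 V // ¬ e.IsDiag} → Bool =>
      ∃ S ∈ (Finset.univ : Finset V).powersetCard d,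
          ∑ v, ∏ u ∈ S, adjInd (graphOfPairs ω) u v < t)
      ⊆ ((Finset.univ : Finset V).powersetCard d).biUnion fun S =>
        Finset.univ.filter fun ω => ∑ v, ∏ u ∈ S, adjInd (graphOfPairs ω) u v < t := by
    intro ω hω
    obtain ⟨S, hS, h⟩ := (Finset.mem_filter.1 hω).2
    exact Finset.mem_biUnion.2 ⟨S, hS, Finset.mem_filter.2 ⟨Finset.mem_univ _, h⟩⟩
  have hcard : (#((Finset.univ : Finset V).powersetCard d) : ℝ) ≤ (Fintype.card V : ℝ) ^ d := by
    rw [Finset.card_powersetCard]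
    exact_mod_cast Nat.choose_le_pow _ _
  refine ((Nat.cast_le (α := ℝ)).2 ((Finset.card_le_card hsub).trans
    Finset.card_biUnion_le)).trans ?_
  push_cast
  refine (Finset.sum_le_card_nsmul _ _ (2 ^ Fintype.card {e : Sym2 V // ¬ e.IsDiag}
      * Real.exp (t - (1 / 2) ^ (d + 1) * (Fintype.card V - d))) fun S hS => ?_).trans ?_
  · have hS' := Finset.mem_powersetCard_univ.1 hS
    have h := card_commonNeighbors_lt_le S t
    rwa [hS', Finset.card_compl, hS', Nat.cast_sub hd] at h
  · rw [nsmul_eq_mul]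
    calc _ ≤ (Fintype.card V : ℝ) ^ d * (2 ^ Fintype.card {e : Sym2 V // ¬ e.IsDiag}
      * Real.exp (t - (1 / 2) ^ (d + 1) * (Fintype.card V - d))) := by gcongr
      _ = _ := by ring

end CommonNeighbors

section Probability

open scoped Classical in
theorem natCard_subtype_graphOfPairs {V : Type*} [Fintype V] [DecidableEq V]
    (P : SimpleGraph V → Prop) :
    Nat.card {G : SimpleGraph V // P G}
      = #{ω : {e : Sym2 V // ¬ e.IsDiag} → Bool | P (graphOfPairs ω)} := by
  rw [← Fintype.card_subtype, ← Nat.card_eq_fintype_card]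
  exact (Nat.card_congr ((Equiv.ofBijective _ graphOfPairs_bijective).subtypeEquiv
    fun _ => Iff.rfl)).symm

theorem natCard_simpleGraph (V : Type*) [Fintype V] [DecidableEq V] :
    Nat.card (SimpleGraph V) = 2 ^ Fintype.card {e : Sym2 V // ¬ e.IsDiag} := by
  classical
  rw [← Nat.card_congr (Equiv.ofBijective _ (graphOfPairs_bijective (V := V))),
    Nat.card_eq_fintype_card, Fintype.card_fun, Fintype.card_bool]

/-- Most graphs have small centred norm and many common neighbours for every `d`-set. -/
theorem one_sub_le_card_div {V : Type*} [Fintype V] [DecidableEq V] {d : ℕ}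
    (hd : d ≤ Fintype.card V) {s t : ℝ} (ht : 0 ≤ t) {P : SimpleGraph V → Prop}
    (hP : ∀ G, CenteredNormLE G (t + 1) →
      (∀ S : Finset V, #S = d → s ≤ ∑ v, ∏ u ∈ S, adjInd G u v) → P G) :
    1 - (2 * 25 ^ Fintype.card V * Real.exp (-(t ^ 2 / 64)) + (Fintype.card V : ℝ) ^ d
        * Real.exp (s - (1 / 2) ^ (d + 1) * (Fintype.card V - d)))
      ≤ (Nat.card {G : SimpleGraph V // P G} : ℝ) / (Nat.card (SimpleGraph V) : ℝ) := by
  classical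
  have h1 := card_not_centeredNormLE_le (V := V) ht
  have h2 := card_exists_commonNeighbors_lt_le (V := V) d s hd
  rw [natCard_simpleGraph, natCard_subtype_graphOfPairs, le_div_iff₀ (by positivity)]
  have hcover : (Finset.univ : Finset ({e : Sym2 V // ¬ e.IsDiag} → Bool))
      ⊆ (Finset.univ.filter fun ω => P (graphOfPairs ω))
        ∪ ((Finset.univ.filter fun ω => ¬ CenteredNormLE (graphOfPairs ω) (t + 1))
          ∪ Finset.univ.filter fun ω => ∃ S ∈ (Finset.univ : Finset V).powersetCard d,
            ∑ v, ∏ u ∈ S, adjInd (graphOfPairs ω) u v < s) := by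
    intro ω _
    simp only [Finset.mem_union, Finset.mem_filter, Finset.mem_univ, true_and]
    by_contra! h
    refine h.1 (hP _ h.2.1 fun S hS => h.2.2 S (Finset.mem_powersetCard_univ.2 hS))
  have h3 := (Finset.card_le_card hcover).trans ((Finset.card_union_le _ _).trans
    (Nat.add_le_add_left (Finset.card_union_le _ _) _))
  rw [Finset.card_univ, Fintype.card_fun, Fintype.card_bool] at h3
  have h4 : ((2 ^ Fintype.card {e : Sym2 V // ¬ e.IsDiag} : ℕ) : ℝ) ≤ _ :=
    (Nat.cast_le (α := ℝ)).2 h3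
  push_cast at h4 ⊢
  linarith

end Probability

section Asymptotics

theorem tendsto_failure_probability (d : ℕ) :
    Tendsto (fun n : ℕ => 1 - (2 * 25 ^ n * Real.exp (-((24 * √(n : ℝ)) ^ 2 / 64))
      + (n : ℝ) ^ d * Real.exp ((1 / 2) ^ (d + 2) * n - (1 / 2) ^ (d + 1) * (n - d))))
      atTop (nhds 1) := by
  have h9 : 25 * Real.exp (-9) < 1 := by
    have h3 : (4 : ℝ) ≤ Real.exp 3 := by linarith [Real.add_one_le_exp (3 : ℝ)]
    have h9 : Real.exp 9 = Real.exp 3 ^ 3 := by rw [← Real.exp_nat_mul]; norm_num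
    have h64 : (4 : ℝ) ^ 3 ≤ Real.exp 3 ^ 3 := pow_le_pow_left₀ (by norm_num) h3 3
    rw [Real.exp_neg, ← div_eq_mul_inv, div_lt_one (Real.exp_pos _), h9]
    linarith
  have hA : Tendsto (fun n : ℕ => 2 * (25 * Real.exp (-9)) ^ n) atTop (nhds (2 * 0)) :=
    (tendsto_pow_atTop_nhds_zero_of_lt_one (by positivity) h9).const_mul 2
  have hB : Tendsto (fun n : ℕ => Real.exp ((1 / 2) ^ (d + 1) * d)
      * ((n : ℝ) ^ d * Real.exp (-((1 / 2) ^ (d + 2))) ^ n)) atTop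
      (nhds (Real.exp ((1 / 2) ^ (d + 1) * d) * 0)) :=
    (tendsto_pow_const_mul_const_pow_of_lt_one d (Real.exp_pos _).le
      (by simp)).const_mul _
  have h := (hA.add hB).const_sub 1
  simp only [mul_zero, add_zero, sub_zero] at h
  refine h.congr fun n => ?_
  rw [mul_pow, mul_pow, ← Real.exp_nat_mul, ← Real.exp_nat_mul, Real.sq_sqrt n.cast_nonneg,
    mul_left_comm (Real.exp ((1 / 2) ^ (d + 1) * d)), ← Real.exp_add, ← mul_assoc]
  congr 2
  · congr 2
    ring
  · congr 2
    ring

theorem half_pow_le_factorial_mul_choose {r k : ℕ} (hk : 2 * r ≤ k) :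
    ((k : ℝ) / 2) ^ r ≤ r.factorial * (k.choose r : ℝ) := by
  have h := Nat.pow_sub_le_descFactorial k r
  rw [Nat.descFactorial_eq_factorial_mul_choose] at h
  have h1 : ((k + 1 - r : ℕ) ^ r : ℝ) ≤ r.factorial * (k.choose r : ℝ) := by exact_mod_cast h
  refine le_trans (pow_le_pow_left₀ (by positivity) ?_ r) h1
  rw [Nat.cast_sub (by omega)]
  have : (2 : ℝ) * r ≤ k := by exact_mod_cast hk
  push_cast
  linarith

theorem pow_le_sqrt_div_log {r n : ℕ} (hr : 1 ≤ r) {k : ℝ} (hk : 0 ≤ k)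
    (h : k ≤ (n : ℝ) ^ ((1 : ℝ) / (2 * r)) / Real.log n ^ ((1 : ℝ) / r)) :
    k ^ r ≤ √(n : ℝ) / Real.log n := by
  have hr0 : (r : ℝ) ≠ 0 := by positivity
  have hlog : 0 ≤ Real.log n := Real.log_natCast_nonneg n
  refine (pow_le_pow_left₀ hk h r).trans_eq ?_
  rw [div_pow, ← Real.rpow_mul_natCast n.cast_nonneg, ← Real.rpow_mul_natCast hlog,
    Real.sqrt_eq_rpow]
  congr 1
  · congr 1
    field_simp
  · rw [one_div_mul_cancel hr0, Real.rpow_one]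

theorem eventually_clique_numerics (r : ℕ) (hr : 1 ≤ r) {c : ℝ} (hc : 0 < c) :
    ∀ᶠ n : ℕ in atTop, ∀ k : ℕ,
      (k : ℝ) ≤ (n : ℝ) ^ ((1 : ℝ) / (2 * r)) / Real.log n ^ ((1 : ℝ) / r) → 2 * r ≤ k →
      4 ^ r * ((k : ℝ) ^ (2 * r) * ((2 * r : ℕ) ^ 2 * (24 * √(n : ℝ) + 1)))
        ≤ (n : ℝ) * ((k.choose r : ℝ) / ((2 * r).choose r : ℝ)
          * ((1 / 2) ^ ((2 * r) ^ 2) * c ^ r)) := by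
  obtain ⟨A, hA⟩ : ∃ A : ℝ, A = 4 ^ r * ((2 * r : ℕ) ^ 2 * 25) := ⟨_, rfl⟩
  have hch : (0 : ℝ) < ((2 * r).choose r : ℝ) := by
    exact_mod_cast Nat.choose_pos (by omega : r ≤ 2 * r)
  have hfac : (0 : ℝ) < (r.factorial : ℝ) := by exact_mod_cast r.factorial_pos
  obtain ⟨E, hE⟩ : ∃ E : ℝ, E = (1 / 2) ^ ((2 * r) ^ 2) * c ^ r / ((2 * r).choose r : ℝ) :=
    ⟨_, rfl⟩
  have hE0 : 0 < E := by rw [hE]; positivity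
  have hA0 : 0 ≤ A := by rw [hA]; positivity
  obtain ⟨D, hD⟩ : ∃ D : ℝ, D = E / (2 ^ r * r.factorial) := ⟨_, rfl⟩
  have hD0 : 0 < D := by rw [hD]; positivity
  have hlog : Tendsto (fun n : ℕ => Real.log n) atTop atTop :=
    Real.tendsto_log_atTop.comp tendsto_natCast_atTop_atTop
  filter_upwards [hlog.eventually_ge_atTop (A / D), eventually_ge_atTop 2] with n hn h2 k hk hrk
  have hL : 0 < Real.log n := Real.log_pos (by exact_mod_cast h2)
  have hkr := pow_le_sqrt_div_log hr k.cast_nonneg hk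
  have hsq : √(n : ℝ) * √(n : ℝ) = n := Real.mul_self_sqrt n.cast_nonneg
  have hs1 : 1 ≤ √(n : ℝ) := Real.one_le_sqrt.2 (by exact_mod_cast (by omega : 1 ≤ n))
  have hAD : A / Real.log n ≤ D := by
    rw [div_le_iff₀ hL]
    rwa [div_le_iff₀ hD0, mul_comm] at hn
  have hchoose := half_pow_le_factorial_mul_choose hrk
  calc 4 ^ r * ((k : ℝ) ^ (2 * r) * ((2 * r : ℕ) ^ 2 * (24 * √(n : ℝ) + 1)))
      ≤ 4 ^ r * ((k : ℝ) ^ (2 * r) * ((2 * r : ℕ) ^ 2 * (25 * √(n : ℝ)))) := by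
        gcongr
        linarith
    _ = A * k ^ r * √(n : ℝ) * k ^ r := by rw [hA, two_mul r, pow_add]; ring
    _ ≤ A * k ^ r * √(n : ℝ) * (√(n : ℝ) / Real.log n) := by gcongr
    _ = (A / Real.log n) * (k ^ r * (√(n : ℝ) * √(n : ℝ))) := by ring
    _ = (A / Real.log n) * (k ^ r * n) := by rw [hsq]
    _ ≤ D * (k ^ r * n) := by gcongr
    _ = n * (((k : ℝ) / 2) ^ r / r.factorial * E) := by rw [hD, div_pow]; field_simp
    _ ≤ n * (k.choose r * E) := by
        gcongr
        rwa [div_le_iff₀ hfac, mul_comm]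
    _ = _ := by rw [hE]; ring

/-- Common-neighbour bounds pass to smaller sets. -/
theorem le_sum_prod_adjInd_of_card_le {V : Type*} [Fintype V] {G : SimpleGraph V} {d : ℕ} {s : ℝ}
    (hd : d ≤ Fintype.card V) (h : ∀ S : Finset V, #S = d → s ≤ ∑ v, ∏ u ∈ S, adjInd G u v)
    {U : Finset V} (hU : #U ≤ d) : s ≤ ∑ v, ∏ u ∈ U, adjInd G u v := by
  obtain ⟨S, hUS, -, hS⟩ := Finset.exists_subsuperset_card_eq (Finset.subset_univ U) hU
    (by rwa [Finset.card_univ])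
  refine (h S hS).trans (Finset.sum_le_sum fun v _ => ?_)
  classical
  rw [← Finset.prod_sdiff hUS]
  exact mul_le_of_le_one_left (Finset.prod_nonneg fun _ _ => adjInd_nonneg _ _ _)
    (Finset.prod_le_one (fun _ _ => adjInd_nonneg _ _ _) fun _ _ => adjInd_le_one _ _ _)

end Asymptotics

/-- There is an absolute constant `C > 0` such that for every fixed
integer `r ≥ 1`, with probability tending to `1` as `n → ∞` over `G ← G(n,1/2)` (uniform
over all graphs on `[n]`), the system `Clique(G,k)` admits no `PS(r)` refutation for any
positive integer `k ≤ n^{1/(2r)}/(C^r (log n)^{1/r})`. -/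
theorem no_ps_refutation_clique_whp :
    ∃ C : ℝ, 0 < C ∧ ∀ r : ℕ, 1 ≤ r →
      Tendsto (fun n : ℕ =>
        (Nat.card {G : SimpleGraph (Fin n) //
          ∀ k : ℕ, 1 ≤ k →
            (k : ℝ) ≤ (n : ℝ) ^ ((1:ℝ)/(2*r)) / (C ^ r * (Real.log n) ^ ((1:ℝ)/r)) →
            ¬ HasPSRefutationClique n r k G} : ℝ)
          / (Nat.card (SimpleGraph (Fin n)) : ℝ))
        atTop (nhds 1) := by
  refine ⟨1, one_pos, fun r hr => ?_⟩
  refine tendsto_of_tendsto_of_tendsto_of_le_of_le' (tendsto_failure_probability (2 * r))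
    tendsto_const_nhds ?_ (Eventually.of_forall fun n => ?_)
  · have hc : (0 : ℝ) < (1 / 2) ^ (2 * r + 2) := by positivity
    filter_upwards [eventually_clique_numerics r hr hc, eventually_ge_atTop (2 * r)]
      with n hn h2r
    have hd : 2 * r ≤ Fintype.card (Fin n) := by simpa using h2r
    have h := one_sub_le_card_div (s := (1 / 2) ^ (2 * r + 2) * n) hd
      (by positivity : 0 ≤ 24 * √(n : ℝ)) (P := fun G => ∀ k : ℕ, 1 ≤ k →
        (k : ℝ) ≤ (n : ℝ) ^ ((1:ℝ)/(2*r)) / (1 ^ r * (Real.log n) ^ ((1:ℝ)/r)) →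
        ¬ HasPSRefutationClique n r k G) fun G hG hS k hk hkn => ?_
    · simpa only [Fintype.card_fin] using h
    · rw [one_pow, one_mul] at hkn
      exact not_hasPSRefutationClique (by omega) hr hk (by positivity) hc hG
        (fun U hU => le_sum_prod_adjInd_of_card_le hd hS hU) (hn k hkn)
  · exact div_le_one_of_le₀ (by exact_mod_cast Finite.card_subtype_le _) (Nat.cast_nonneg _)
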